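/- arXiv:math/0512300 — 10 statements merged into one kernel-verified Lean document; each statement's English description precedes it below -/
import Mathlib

section
/- Let K be a field and R = K[x,y,z,t]. Let h, F, G ∈ K[z,t] be homogeneous polynomials with h ≠ 0, F and G nonconstant, and such that x, y, F, G is a regular sequence in R (equivalently, F, G is a regular sequence in K[z,t]). Let A ∈ K[x,z,t] and B ∈ K[y,z,t] be homogeneous polynomials (possibly zero) satisfying deg A + 1 = deg h + deg F and deg B + 1 = deg h + deg G whenever they are nonzero. Then the following equality of ideals of R holds: (x, yB + hG) ∩ (y, xA + hF) = (xy, x²A + xhF, y²B + yhG, xAG + yBF + hFG). -/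
open MvPolynomial

/-- In a weakly regular sequence on `R`, multiplication by an entry is injective modulo the ideal
generated by the previous entries. -/
theorem RingTheory.Sequence.IsWeaklyRegular.mem_of_mul_mem {R : Type*} [CommRing R] {rs : List R}
    (hrs : RingTheory.Sequence.IsWeaklyRegular R rs) (i : ℕ) (hi : i < rs.length) {r : R}
    (hr : rs[i] * r ∈ Ideal.ofList (rs.take i)) : r ∈ Ideal.ofList (rs.take i) := by
  have key := hrs.regular_mod_prev i hi
  rw [isSMulRegular_quotient_iff_mem_of_smul_mem] at key
  simpa using key r (by simpa using hr)

/-- The substitution `x = y = 0` in `K[x, y, z, t]`. -/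
noncomputable def substZeroXY (K : Type*) [Field K] :
    MvPolynomial (Fin 4) K →ₐ[K] MvPolynomial (Fin 4) K :=
  aeval ![0, 0, X 2, X 3]

theorem sub_substZeroXY_mem {K : Type*} [Field K] (p : MvPolynomial (Fin 4) K) :
    p - substZeroXY K p ∈ Ideal.span ({X 0, X 1} : Set (MvPolynomial (Fin 4) K)) := by
  rw [← Ideal.Quotient.mk_eq_mk_iff_sub_mem]
  have hx : Ideal.Quotient.mkₐ K (Ideal.span ({X 0, X 1} : Set (MvPolynomial (Fin 4) K))) (X 0)
      = 0 := Ideal.Quotient.eq_zero_iff_mem.mpr (Ideal.subset_span (by simp))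
  have hy : Ideal.Quotient.mkₐ K (Ideal.span ({X 0, X 1} : Set (MvPolynomial (Fin 4) K))) (X 1)
      = 0 := Ideal.Quotient.eq_zero_iff_mem.mpr (Ideal.subset_span (by simp))
  have hhom : Ideal.Quotient.mkₐ K (Ideal.span ({X 0, X 1} : Set (MvPolynomial (Fin 4) K))) =
      (Ideal.Quotient.mkₐ K _).comp (substZeroXY K) := by
    apply MvPolynomial.algHom_ext
    intro i
    fin_cases i <;> simp [substZeroXY] <;> assumption
  exact DFunLike.congr_fun hhom p

theorem mem_span_X_zero_X_one_iff {K : Type*} [Field K] {p : MvPolynomial (Fin 4) K} :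
    p ∈ Ideal.span ({X 0, X 1} : Set (MvPolynomial (Fin 4) K)) ↔ substZeroXY K p = 0 := by
  constructor
  · rw [Ideal.mem_span_pair]
    rintro ⟨a, b, rfl⟩
    simp [substZeroXY]
  · intro hp
    simpa [hp] using sub_substZeroXY_mem p

theorem substZeroXY_eq_self {K : Type*} [Field K] {p : MvPolynomial (Fin 4) K}
    (hp : p ∈ Algebra.adjoin K ({X 2, X 3} : Set (MvPolynomial (Fin 4) K))) :
    substZeroXY K p = p := by
  have hle : Algebra.adjoin K ({X 2, X 3} : Set (MvPolynomial (Fin 4) K)) ≤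
      AlgHom.equalizer (substZeroXY K) (AlgHom.id K _) := by
    rw [Algebra.adjoin_le_iff]
    rintro q (rfl | rfl) <;> simp [substZeroXY]
  exact hle hp

/-- A nonzero polynomial in `z, t` can be cancelled modulo `(x, y)`. -/
theorem mem_span_X_zero_X_one_of_mul_mem {K : Type*} [Field K] {h p : MvPolynomial (Fin 4) K}
    (hmem : h ∈ Algebra.adjoin K ({X 2, X 3} : Set (MvPolynomial (Fin 4) K))) (hne : h ≠ 0)
    (hp : h * p ∈ Ideal.span ({X 0, X 1} : Set (MvPolynomial (Fin 4) K))) :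
    p ∈ Ideal.span ({X 0, X 1} : Set (MvPolynomial (Fin 4) K)) := by
  rw [mem_span_X_zero_X_one_iff, map_mul, substZeroXY_eq_self hmem] at hp
  exact mem_span_X_zero_X_one_iff.mpr ((mul_eq_zero.mp hp).resolve_left hne)

/-- The equality of ideals in Case 2.2 of Lemma 2.1 (Theorem 1.2) of
"The equations of space curves on a quadric" by Di Gennaro and Nagel:
for a curve on the reducible quadric `{xy = 0}` that is the union of two planar
curves meeting along the divisor `{h = 0}` of the line `{x = y = 0}`, one has
`(x, yB + hG) ∩ (y, xA + hF) = (xy, x²A + xhF, y²B + yhG, xAG + yBF + hFG)`. -/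
theorem ideal_intersection_reducible_quadric
    {K : Type*} [Field K]
    (h F G A B : MvPolynomial (Fin 4) K) (dh dF dG dA dB : ℕ)
    -- h, F, G ∈ K[z,t]
    (hmem : h ∈ Algebra.adjoin K ({X 2, X 3} : Set (MvPolynomial (Fin 4) K)))
    (Fmem : F ∈ Algebra.adjoin K ({X 2, X 3} : Set (MvPolynomial (Fin 4) K)))
    (Gmem : G ∈ Algebra.adjoin K ({X 2, X 3} : Set (MvPolynomial (Fin 4) K)))
    -- A ∈ K[x,z,t], B ∈ K[y,z,t]
    (Amem : A ∈ Algebra.adjoin K ({X 0, X 2, X 3} : Set (MvPolynomial (Fin 4) K)))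
    (Bmem : B ∈ Algebra.adjoin K ({X 1, X 2, X 3} : Set (MvPolynomial (Fin 4) K)))
    -- homogeneity
    (hhom : h.IsHomogeneous dh) (Fhom : F.IsHomogeneous dF) (Ghom : G.IsHomogeneous dG)
    (Ahom : A.IsHomogeneous dA) (Bhom : B.IsHomogeneous dB)
    -- h ≠ 0, F and G nonconstant
    (hne : h ≠ 0) (Fnc : F.totalDegree ≠ 0) (Gnc : G.totalDegree ≠ 0)
    -- degree conditions (whenever A resp. B is nonzero)
    (hdA : A ≠ 0 → dA + 1 = dh + dF) (hdB : B ≠ 0 → dB + 1 = dh + dG)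
    -- x, y, F, G is a regular sequence in R
    (hreg : RingTheory.Sequence.IsRegular (MvPolynomial (Fin 4) K) [X 0, X 1, F, G]) :
    Ideal.span {X 0, X 1 * B + h * G} ⊓ Ideal.span {X 1, X 0 * A + h * F} =
      Ideal.span {X 0 * X 1, X 0 ^ 2 * A + X 0 * h * F, X 1 ^ 2 * B + X 1 * h * G,
        X 0 * A * G + X 1 * B * F + h * F * G} := by
  have hF {r : MvPolynomial (Fin 4) K} (hr : F * r ∈ Ideal.span {X 0, X 1}) :
      r ∈ Ideal.span {X 0, X 1} := by
    have key := hreg.toIsWeaklyRegular.mem_of_mul_mem 2 (by simp) (r := r)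
    simp only [List.take, Ideal.ofList_cons, Ideal.ofList_nil, sup_bot_eq,
      ← Ideal.span_insert] at key
    exact key hr
  have hG {r : MvPolynomial (Fin 4) K} (hr : G * r ∈ Ideal.span {X 0, X 1, F}) :
      r ∈ Ideal.span {X 0, X 1, F} := by
    have key := hreg.toIsWeaklyRegular.mem_of_mul_mem 3 (by simp) (r := r)
    simp only [List.take, Ideal.ofList_cons, Ideal.ofList_nil, sup_bot_eq,
      ← Ideal.span_insert] at key
    exact key hr
  apply le_antisymm
  · rintro f ⟨hf₁, hf₂⟩
    obtain ⟨a, b, hab⟩ := Ideal.mem_span_pair.mp hf₁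
    obtain ⟨c, d, hcd⟩ := Ideal.mem_span_pair.mp hf₂
    have hbd : G * b - F * d ∈ Ideal.span {X 0, X 1} := by
      refine mem_span_X_zero_X_one_of_mul_mem hmem hne (Ideal.mem_span_pair.mpr
        ⟨d * A - a, c - b * B, ?_⟩)
      linear_combination hcd - hab
    have hb : b ∈ Ideal.span {X 0, X 1, F} := by
      obtain ⟨u, v, huv⟩ := Ideal.mem_span_pair.mp hbd
      refine hG (Submodule.mem_span_triple.mpr ⟨u, v, d, ?_⟩)
      simp only [smul_eq_mul]
      linear_combination huv
    obtain ⟨b₁, b₂, b₃, hb⟩ := Submodule.mem_span_triple.mp hb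
    simp only [smul_eq_mul] at hb
    have hd : d - b₃ * G ∈ Ideal.span {X 0, X 1} := by
      refine hF (mem_span_X_zero_X_one_of_mul_mem hmem hne (Ideal.mem_span_pair.mpr
        ⟨a + b₁ * (X 1 * B + h * G) - d * A, b₂ * (X 1 * B + h * G) + b₃ * B * F - c, ?_⟩))
      linear_combination hab - hcd + (X 1 * B + h * G) * hb
    obtain ⟨d₁, d₂, hd⟩ := Ideal.mem_span_pair.mp hd
    have hdvd : (X 0 : MvPolynomial (Fin 4) K) ∣
        X 1 * (c + d₂ * (X 0 * A + h * F) - b₂ * (X 1 * B + h * G) - b₃ * B * F) := by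
      refine ⟨a + b₁ * (X 1 * B + h * G) - b₃ * A * G - d₁ * (X 0 * A + h * F), ?_⟩
      linear_combination hcd - hab - (X 1 * B + h * G) * hb + (X 0 * A + h * F) * hd
    obtain ⟨e, he⟩ := (X_dvd_mul_iff.mp hdvd).resolve_left (by simp [X_dvd_X])
    simp only [Ideal.mem_span_insert', Ideal.mem_span_singleton']
    refine ⟨-e, -d₁, -b₂, b₃, ?_⟩
    linear_combination hcd + (X 0 * A + h * F) * hd - X 1 * he
  · rw [Ideal.span_le]
    rintro p (rfl | rfl | rfl | rfl) <;>
      refine ⟨Ideal.mem_span_pair.mpr ?_, Ideal.mem_span_pair.mpr ?_⟩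
    · exact ⟨X 1, 0, by ring⟩
    · exact ⟨X 0, 0, by ring⟩
    · exact ⟨X 0 * A + h * F, 0, by ring⟩
    · exact ⟨0, X 0, by ring⟩
    · exact ⟨0, X 1, by ring⟩
    · exact ⟨X 1 * B + h * G, 0, by ring⟩
    · exact ⟨A * G, F, by ring⟩
    · exact ⟨B * F, G, by ring⟩
end

section
/- Let K be a field and R = K[x,y,z,t]. Let h, F, G ∈ K[z,t] be homogeneous with F, G nonconstant, let A ∈ K[x,z,t] and B ∈ K[y,z,t] be homogeneous with deg A + 1 = deg h + deg F and deg B + 1 = deg h + deg G whenever they are nonzero, and assume A·B ≠ 0 in case h = 0. Then the ideal J = (xy, x²A + xhF, y²B + yhG, xAG + yBF + hFG) of R cannot be generated by 3 elements; that is, there is no set S ⊆ R with |S| ≤ 3 and Ideal.span S = J (so J has exactly 4 minimal generators). -/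
open MvPolynomial

/-- If every relation among the `g i` has all its coefficients in the kernel of a fixed ring
homomorphism to a field, then the ideal they span needs at least `card ι` generators. -/
theorem card_le_card_of_span_eq_of_syzygies {R K ι : Type*} [CommRing R] [Field K] [Fintype ι]
    (ε : R →+* K) (g : ι → R) (hg : ∀ c : ι → R, ∑ i, c i * g i = 0 → ∀ i, ε (c i) = 0)
    (S : Finset R) (hS : Ideal.span (S : Set R) = Ideal.span (Set.range g)) :
    Fintype.card ι ≤ S.card := by
  classical
  have hP : ∀ i, ∃ c : S → R, ∑ s, c s * (s : R) = g i := fun i => by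
    have hi : g i ∈ Ideal.span (Set.range ((↑) : S → R)) := by
      simpa [hS] using Ideal.subset_span (Set.mem_range_self i)
    exact (Ideal.mem_span_range_iff_exists_fun).1 hi
  have hQ : ∀ s : S, ∃ c : ι → R, ∑ i, c i * g i = (s : R) := fun s => by
    rw [← Ideal.mem_span_range_iff_exists_fun, ← hS]
    exact Ideal.subset_span s.2
  choose P hP using hP
  choose Q hQ using hQ
  have hPQ : (Matrix.of P * Matrix.of Q).map ε = 1 := by
    ext i j
    have hsyz : ∑ k, ((Matrix.of P * Matrix.of Q) i k - (1 : Matrix ι ι R) i k) * g k = 0 := by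
      simp only [sub_mul, Finset.sum_sub_distrib, Matrix.mul_apply, Matrix.of_apply,
        Finset.sum_mul, Matrix.one_apply, ite_mul, one_mul, zero_mul, Finset.sum_ite_eq,
        Finset.mem_univ, if_true]
      rw [Finset.sum_comm]
      simp only [mul_assoc, ← Finset.mul_sum, hQ, hP, sub_self]
    have h := hg _ hsyz j
    rw [map_sub, sub_eq_zero] at h
    rw [Matrix.map_apply, h, Matrix.one_apply, Matrix.one_apply]
    split_ifs <;> simp
  rw [Matrix.map_mul] at hPQ
  calc Fintype.card ι = (1 : Matrix ι ι K).rank := Matrix.rank_one.symm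
    _ = ((Matrix.of P).map ε * (Matrix.of Q).map ε).rank := by rw [hPQ]
    _ ≤ ((Matrix.of P).map ε).rank := Matrix.rank_mul_le_left _ _
    _ ≤ Fintype.card S := Matrix.rank_le_card_width _
    _ = S.card := Fintype.card_coe S

namespace MvPolynomial

variable {σ K : Type*}

theorem IsHomogeneous.constantCoeff_eq_zero_of_totalDegree_ne_zero [CommSemiring K]
    {p : MvPolynomial σ K} {n : ℕ} (hp : p.IsHomogeneous n) (hn : p.totalDegree ≠ 0) :
    constantCoeff p = 0 := by
  have hp0 : p ≠ 0 := by rintro rfl; simp at hn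
  rw [hp.totalDegree hp0] at hn
  exact hp.coeff_eq_zero (by simpa using hn.symm)

variable [DecidableEq σ]

/-- The substitution setting the variables in `s` to zero. -/
noncomputable def killVars (K : Type*) [CommSemiring K] (s : Finset σ) :
    MvPolynomial σ K →ₐ[K] MvPolynomial σ K :=
  aeval fun i => if i ∈ s then 0 else X i

@[simp]
theorem killVars_X [CommSemiring K] (s : Finset σ) (i : σ) :
    killVars K s (X i) = if i ∈ s then 0 else X i :=
  aeval_X _ _

@[simp]
theorem constantCoeff_killVars [CommSemiring K] (s : Finset σ) (p : MvPolynomial σ K) :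
    constantCoeff (killVars K s p) = constantCoeff p := by
  induction p using MvPolynomial.induction_on with
  | C a => simp [killVars]
  | add p q hp hq => simp [hp, hq]
  | mul_X p i hp => rw [map_mul, map_mul, killVars_X]; split_ifs <;> simp

theorem killVars_eq_self [CommSemiring K] {s : Finset σ} {T : Set (MvPolynomial σ K)}
    {p : MvPolynomial σ K} (hp : p ∈ Algebra.adjoin K T) (hT : ∀ q ∈ T, killVars K s q = q) :
    killVars K s p = p :=
  AlgHom.adjoin_le_equalizer (killVars K s) (AlgHom.id K _) hT hp

theorem killVars_eq_C [CommSemiring K] {s : Finset σ} {T : Set (MvPolynomial σ K)}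
    {p : MvPolynomial σ K} (hp : p ∈ Algebra.adjoin K T) (hT : ∀ q ∈ T, ∃ i ∈ s, X i = q) :
    killVars K s p = C (constantCoeff p) := by
  induction hp using Algebra.adjoin_induction with
  | mem q hq => obtain ⟨i, hi, rfl⟩ := hT q hq; simp [hi]
  | algebraMap r => simp [algebraMap_eq, killVars]
  | add p q _ _ hp hq => simp [hp, hq]
  | mul p q _ _ hp hq => simp [hp, hq]

/-- If `c x (xA + hF) + d G (xA + hF) = 0` with `xA + hF ≠ 0`, `x` the variable `X i`, and
`h`, `F`, `G` not involving it, then `c` and `d` have no constant term. -/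
theorem constantCoeff_eq_zero_of_relation [Field K] {i : σ} {s : Finset σ} (his : i ∉ s)
    {h F G A c d : MvPolynomial σ K} (hh : killVars K {i} h = h) (hF : killVars K {i} F = F)
    (hG : killVars K {i} G = G) (hGs : killVars K s G = 0) (F0 : F ≠ 0) (G0 : G ≠ 0)
    (hA : h = 0 → A ≠ 0)
    (hrel : c * (X i ^ 2 * A + X i * h * F) + d * (X i * A * G + h * F * G) = 0) :
    constantCoeff c = 0 ∧ constantCoeff d = 0 := by
  have hne : X i * A + h * F ≠ 0 := fun h0 => by
    have h1 := congrArg (killVars K {i}) h0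
    have hz : h = 0 := by simpa [hh, hF, F0] using h1
    exact hA hz (by simpa [hz] using h0)
  have hcd : c * X i + d * G = 0 :=
    (mul_eq_zero.1 (show (X i * A + h * F) * (c * X i + d * G) = 0 by
      linear_combination hrel)).resolve_left hne
  constructor
  · have h1 : killVars K s c = 0 := by simpa [hGs, his] using congrArg (killVars K s) hcd
    rw [← constantCoeff_killVars s, h1, map_zero]
  · have h1 : killVars K {i} d = 0 := by simpa [hG, G0] using congrArg (killVars K {i}) hcd
    rw [← constantCoeff_killVars {i}, h1, map_zero]

theorem constantCoeff_eq_zero_of_mul_X_mul_X [CommRing K] {i j : σ} (hij : i ≠ j)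
    {a b c : MvPolynomial σ K} (habc : c * X i * X j + a * X i * X i + b * X j * X j = 0) :
    constantCoeff c = 0 := by
  have h1 := congrArg (coeff (Finsupp.single i 1 + Finsupp.single j 1)) habc
  simpa [coeff_mul_X', hij, hij.symm, constantCoeff_eq, Finsupp.single_apply, add_tsub_cancel_right]
    using h1

end MvPolynomial

/-- The minimality assertion of Lemma 2.2 / Theorem 1.2 of "The equations of space
curves on a quadric" by Di Gennaro and Nagel: the ideal
`J = (xy, x²A + xhF, y²B + yhG, xAG + yBF + hFG)` cannot be generated by 3 elements,
i.e. `μ(J) = 4`. -/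
theorem four_minimal_generators_reducible_quadric
    {K : Type*} [Field K]
    (h F G A B : MvPolynomial (Fin 4) K) (dh dF dG dA dB : ℕ)
    -- h, F, G ∈ K[z,t]
    (hmem : h ∈ Algebra.adjoin K ({X 2, X 3} : Set (MvPolynomial (Fin 4) K)))
    (Fmem : F ∈ Algebra.adjoin K ({X 2, X 3} : Set (MvPolynomial (Fin 4) K)))
    (Gmem : G ∈ Algebra.adjoin K ({X 2, X 3} : Set (MvPolynomial (Fin 4) K)))
    -- A ∈ K[x,z,t], B ∈ K[y,z,t]
    (Amem : A ∈ Algebra.adjoin K ({X 0, X 2, X 3} : Set (MvPolynomial (Fin 4) K)))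
    (Bmem : B ∈ Algebra.adjoin K ({X 1, X 2, X 3} : Set (MvPolynomial (Fin 4) K)))
    -- homogeneity
    (hhom : h.IsHomogeneous dh) (Fhom : F.IsHomogeneous dF) (Ghom : G.IsHomogeneous dG)
    (Ahom : A.IsHomogeneous dA) (Bhom : B.IsHomogeneous dB)
    -- F and G nonconstant
    (Fnc : F.totalDegree ≠ 0) (Gnc : G.totalDegree ≠ 0)
    -- degree conditions (whenever A resp. B is nonzero)
    (hdA : A ≠ 0 → dA + 1 = dh + dF) (hdB : B ≠ 0 → dB + 1 = dh + dG)
    -- A·B ≠ 0 in case h = 0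
    (hAB : h = 0 → A * B ≠ 0) :
    ¬ ∃ S : Finset (MvPolynomial (Fin 4) K), S.card ≤ 3 ∧
      Ideal.span (S : Set (MvPolynomial (Fin 4) K)) =
        Ideal.span {X 0 * X 1, X 0 ^ 2 * A + X 0 * h * F,
          X 1 ^ 2 * B + X 1 * h * G, X 0 * A * G + X 1 * B * F + h * F * G} := by
  rintro ⟨S, hcard, hspan⟩
  have F0 : F ≠ 0 := by rintro rfl; simp at Fnc
  have G0 : G ≠ 0 := by rintro rfl; simp at Gnc
  have hFs : killVars K {2, 3} F = 0 := by
    rw [killVars_eq_C Fmem (by simp), Fhom.constantCoeff_eq_zero_of_totalDegree_ne_zero Fnc, C_0]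
  have hGs : killVars K {2, 3} G = 0 := by
    rw [killVars_eq_C Gmem (by simp), Ghom.constantCoeff_eq_zero_of_totalDegree_ne_zero Gnc, C_0]
  have h0 : killVars K {0} h = h := killVars_eq_self hmem (by simp)
  have h1 : killVars K {1} h = h := killVars_eq_self hmem (by simp)
  have F0' : killVars K {0} F = F := killVars_eq_self Fmem (by simp)
  have F1' : killVars K {1} F = F := killVars_eq_self Fmem (by simp)
  have G0' : killVars K {0} G = G := killVars_eq_self Gmem (by simp)
  have G1' : killVars K {1} G = G := killVars_eq_self Gmem (by simp)
  have A1' : killVars K {1} A = A := killVars_eq_self Amem (by simp)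
  have B0' : killVars K {0} B = B := killVars_eq_self Bmem (by simp)
  have hle := card_le_card_of_span_eq_of_syzygies constantCoeff
    ![X 0 * X 1, X 0 ^ 2 * A + X 0 * h * F, X 1 ^ 2 * B + X 1 * h * G,
      X 0 * A * G + X 1 * B * F + h * F * G] (fun c hc => ?_) S (by
      simpa only [Matrix.range_cons, Matrix.range_empty, Set.union_empty, Set.singleton_union]
        using hspan)
  · rw [Fintype.card_fin] at hle
    omega
  · simp only [Fin.sum_univ_four, Matrix.cons_val] at hc
    obtain ⟨hc1, hc3⟩ := constantCoeff_eq_zero_of_relation (i := 0) (s := {2, 3}) (by simp)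
      (c := killVars K {1} (c 1)) (d := killVars K {1} (c 3)) h0 F0' G0' hGs F0 G0
      (fun hz => left_ne_zero_of_mul (hAB hz))
      (by simpa [h1, F1', G1', A1'] using congrArg (killVars K {1}) hc)
    obtain ⟨hc2, -⟩ := constantCoeff_eq_zero_of_relation (i := 1) (s := {2, 3}) (by simp)
      (c := killVars K {0} (c 2)) (d := killVars K {0} (c 3)) h1 G1' F1' hFs G0 F0
      (fun hz => right_ne_zero_of_mul (hAB hz))
      (by
        have := congrArg (killVars K {0}) hc
        simp [h0, F0', G0', B0'] at this
        linear_combination this)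
    have hc0 : constantCoeff (killVars K {2, 3} (c 0)) = 0 := by
      refine constantCoeff_eq_zero_of_mul_X_mul_X (i := 0) (j := 1) (by simp)
        (a := killVars K {2, 3} (c 1 * A)) (b := killVars K {2, 3} (c 2 * B)) ?_
      have := congrArg (killVars K {2, 3}) hc
      simp [hFs, hGs] at this
      simp only [map_mul]
      linear_combination this
    simp only [constantCoeff_killVars] at hc0 hc1 hc2 hc3
    intro i
    fin_cases i <;> assumption
end

section
/- Let K be a field and R = K[x,y,z,t]. Let h, F, G ∈ K[z,t] with F, G nonconstant, let A ∈ K[x,z,t] and B ∈ K[y,z,t], and assume A·B ≠ 0 in case h = 0. Let J ⊆ R be the ideal J = (xy, x²A + xhF, y²B + yhG, xAG + yBF + hFG), regarded as an R-module. Then there is an isomorphism of R-modules Ext²_R(J, R) ≅ R/(x, y, F, G). -/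
open MvPolynomial CategoryTheory

section Resolution

open Limits
open scoped ZeroObject

universe v u

variable {C : Type u} [Category.{v} C] [Abelian C] {P₂ P₁ P₀ M : C}
  (d₂ : P₂ ⟶ P₁) (d₁ : P₁ ⟶ P₀) (e : P₀ ⟶ M) (w : d₂ ≫ d₁ = 0) (we : d₁ ≫ e = 0)

/-- The chain complex `0 ⟶ P₂ ⟶ P₁ ⟶ P₀` with `P₀` in degree zero. -/
noncomputable def ChainComplex.ofTwoMaps : ChainComplex C ℕ :=
  ChainComplex.mk P₀ P₁ P₂ d₁ d₂ w fun _ => ⟨0, 0, zero_comp⟩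

lemma ChainComplex.isZero_ofTwoMaps_X (n : ℕ) :
    IsZero ((ChainComplex.ofTwoMaps d₂ d₁ w).X (n + 3)) :=
  (isZero_zero C).of_iso (ChainComplex.mkXIso P₀ P₁ P₂ d₁ d₂ w (fun _ => ⟨0, 0, zero_comp⟩) n)

lemma ChainComplex.ofTwoMaps_d_one_zero : (ChainComplex.ofTwoMaps d₂ d₁ w).d 1 0 = d₁ :=
  ChainComplex.mk_d_1_0 ..

lemma ChainComplex.ofTwoMaps_d_two_one : (ChainComplex.ofTwoMaps d₂ d₁ w).d 2 1 = d₂ :=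
  ChainComplex.mk_d_2_1 ..

lemma ChainComplex.ofTwoMaps_exactAt_succ [Mono d₂] (h₁ : (ShortComplex.mk d₂ d₁ w).Exact)
    (n : ℕ) : (ChainComplex.ofTwoMaps d₂ d₁ w).ExactAt (n + 1) := by
  match n with
  | 0 =>
    rw [HomologicalComplex.exactAt_iff' _ 2 1 0 (by simp) (by simp)]
    refine (ShortComplex.exact_iff_of_iso ?_).2 h₁
    exact ShortComplex.isoMk (Iso.refl P₂) (Iso.refl P₁) (Iso.refl P₀)
      ((Category.id_comp _).trans
        ((ChainComplex.ofTwoMaps_d_two_one d₂ d₁ w).symm.trans (Category.comp_id _).symm))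
      ((Category.id_comp _).trans
        ((ChainComplex.ofTwoMaps_d_one_zero d₂ d₁ w).symm.trans (Category.comp_id _).symm))
  | 1 =>
    rw [HomologicalComplex.exactAt_iff' _ 3 2 1 (by simp) (by simp)]
    refine (ShortComplex.exact_iff_mono (HomologicalComplex.sc' _ 3 2 1)
      ((ChainComplex.isZero_ofTwoMaps_X d₂ d₁ w 0).eq_of_src _ _)).2 ?_
    change Mono ((ChainComplex.ofTwoMaps d₂ d₁ w).d 2 1)
    rwa [ChainComplex.ofTwoMaps_d_two_one]
  | n + 2 => exact .of_isZero (ChainComplex.isZero_ofTwoMaps_X d₂ d₁ w n)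

lemma ChainComplex.projective_ofTwoMaps_X [Projective P₂] [Projective P₁] [Projective P₀] (n : ℕ) :
    Projective ((ChainComplex.ofTwoMaps d₂ d₁ w).X n) := by
  match n with
  | 0 => exact inferInstanceAs (Projective P₀)
  | 1 => exact inferInstanceAs (Projective P₁)
  | 2 => exact inferInstanceAs (Projective P₂)
  | n + 3 => exact (ChainComplex.isZero_ofTwoMaps_X d₂ d₁ w n).projective

/-- The projective resolution given by an exact sequence `0 ⟶ P₂ ⟶ P₁ ⟶ P₀ ⟶ M ⟶ 0` with
projective `Pᵢ`. -/
noncomputable def CategoryTheory.ProjectiveResolution.ofTwoMaps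
    [Projective P₂] [Projective P₁] [Projective P₀] [Mono d₂] [Epi e]
    (h₁ : (ShortComplex.mk d₂ d₁ w).Exact) (h₀ : (ShortComplex.mk d₁ e we).Exact) :
    ProjectiveResolution M where
  complex := ChainComplex.ofTwoMaps d₂ d₁ w
  projective := ChainComplex.projective_ofTwoMaps_X d₂ d₁ w
  π := (ChainComplex.toSingle₀Equiv _ _).symm
    ⟨e, by rw [ChainComplex.ofTwoMaps_d_one_zero]; exact we⟩
  quasiIso := ⟨fun n => by
    cases n
    · rw [ChainComplex.quasiIsoAt₀_iff, ShortComplex.quasiIso_iff_of_zeros']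
      · refine (ShortComplex.exact_and_epi_g_iff_of_iso ?_).2 ⟨h₀, ‹Epi e›⟩
        exact ShortComplex.isoMk (Iso.refl P₁) (Iso.refl P₀) (Iso.refl M)
          ((Category.id_comp _).trans
        ((ChainComplex.ofTwoMaps_d_one_zero d₂ d₁ w).symm.trans (Category.comp_id _).symm))
          ((Category.id_comp e).trans
            (.trans (ChainComplex.toSingle₀Equiv_symm_apply_f_zero
              (C := ChainComplex.ofTwoMaps d₂ d₁ w) e (by
              rw [ChainComplex.ofTwoMaps_d_one_zero]; exact we)).symm (Category.comp_id _).symm))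
      all_goals rfl
    · rw [quasiIsoAt_iff_exactAt']
      · exact ChainComplex.ofTwoMaps_exactAt_succ d₂ d₁ w h₁ _
      · apply ChainComplex.exactAt_succ_single_obj⟩

/-- For a projective resolution `0 ⟶ P₂ ⟶ P₁ ⟶ P₀ ⟶ M ⟶ 0`, the module `Ext²(M, Y)` is the
cokernel of `Hom(P₁, Y) ⟶ Hom(P₂, Y)`. -/
lemma nonempty_ext_two_iso_of_resolution {R : Type*} [Ring R] [Linear R C] [EnoughProjectives C]
    [Projective P₂] [Projective P₁] [Projective P₀] [Mono d₂] [Epi e]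
    (h₁ : (ShortComplex.mk d₂ d₁ w).Exact) (h₀ : (ShortComplex.mk d₁ e we).Exact) (Y : C) :
    Nonempty (((Ext R C 2).obj (Opposite.op M)).obj Y ≅
      ModuleCat.of R ((P₂ ⟶ Y) ⧸ LinearMap.range (Linear.leftComp R Y d₂))) := by
  let P := ProjectiveResolution.ofTwoMaps d₂ d₁ e w we h₁ h₀
  let S := (P.complex.linearYonedaObj R Y).sc' 1 2 3
  have hS : S.g = 0 := by
    ext (f : P₂ ⟶ Y)
    exact (ChainComplex.isZero_ofTwoMaps_X d₂ d₁ w 0).eq_of_src _ _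
  have hf : LinearMap.range S.f.hom = LinearMap.range (Linear.leftComp R Y d₂) := by
    have : S.f.hom = Linear.leftComp R Y ((ChainComplex.ofTwoMaps d₂ d₁ w).d 2 1) := rfl
    rw [this, ChainComplex.ofTwoMaps_d_two_one]
    rfl
  have := ShortComplex.isIso_homologyι S hS
  exact ⟨P.isoExt 2 Y ≪≫ HomologicalComplex.homologyIsoSc' _ 1 2 3 (by simp) (by simp) ≪≫
    asIso S.homologyι ≪≫ S.moduleCatOpcyclesIso ≪≫
    (Submodule.quotEquivOfEq _ _ hf).toModuleIso⟩

end Resolution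

section Syzygies

variable {R : Type*} [CommRing R]

/-- The relations between `xy`, `x²A + xhF`, `y²B + yhG` and `xAG + yBF + hFG` are generated by
`(BF, G, 0, -x)`, `(AG, 0, F, -y)`, `(xA + hF, -y, 0, 0)` and `(yB + hG, 0, -x, 0)`. -/
lemma exists_syzygy_coeffs [IsDomain R] {x y h F G A B : R} (hx : Prime x) (hy : Prime y)
    (hxy : ¬ x ∣ y) (hyx : ¬ y ∣ x) (hP : ¬ y ∣ x * A + h * F) (hQ : ¬ x ∣ y * B + h * G)
    (hG : ∀ a, a * G ∈ Ideal.span {x, y} → a ∈ Ideal.span {x, y}) {α β γ δ : R}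
    (hrel : α * (x * y) + β * (x ^ 2 * A + x * h * F) + γ * (y ^ 2 * B + y * h * G) +
      δ * (x * A * G + y * B * F + h * F * G) = 0) :
    ∃ p q r s, α = p * (B * F) + q * (A * G) + r * (x * A + h * F) + s * (y * B + h * G) ∧
      β = p * G - r * y ∧ γ = q * F - s * x ∧ δ = -(p * x) - q * y := by
  obtain ⟨m, hm⟩ : y ∣ β * x + δ * G := (hy.dvd_or_dvd (a := x * A + h * F)
    ⟨-(α * x + γ * (y * B + h * G) + δ * B * F), by linear_combination hrel⟩).resolve_left hP
  obtain ⟨n, hn⟩ : x ∣ γ * y + δ * F := (hx.dvd_or_dvd (a := y * B + h * G)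
    ⟨-(α * y + β * (x * A + h * F) + δ * A * G), by linear_combination hrel⟩).resolve_left hQ
  obtain ⟨p, q, hpq⟩ := Ideal.mem_span_pair.1
    (hG δ (Ideal.mem_span_pair.2 ⟨-β, m, by linear_combination -hm⟩))
  obtain ⟨r, hr⟩ : y ∣ β + p * G := (hy.dvd_or_dvd (a := x)
    ⟨m - q * G, by linear_combination hm + G * hpq⟩).resolve_left hyx
  obtain ⟨s, hs⟩ : x ∣ γ + q * F := (hx.dvd_or_dvd (a := y)
    ⟨n - p * F, by linear_combination hn + F * hpq⟩).resolve_left hxy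
  refine ⟨-p, -q, -r, -s, ?_, by linear_combination hr, by linear_combination hs,
    by linear_combination -hpq⟩
  apply mul_left_cancel₀ (mul_ne_zero hx.ne_zero hy.ne_zero)
  linear_combination hrel - (x ^ 2 * A + x * h * F) * hr - (y ^ 2 * B + y * h * G) * hs +
    (x * A * G + y * B * F + h * F * G) * hpq

end Syzygies

section LinearYoneda

universe u

variable {R : Type u} [CommRing R]

lemma nonempty_quotient_range_leftComp_iso {ι : Type} [Fintype ι] (v : ι → R) :
    Nonempty (ModuleCat.of R ((ModuleCat.of R R ⟶ ModuleCat.of R R) ⧸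
      LinearMap.range (Linear.leftComp R (ModuleCat.of R R)
        (ModuleCat.ofHom (LinearMap.toSpanSingleton R (ι → R) v)))) ≅
      ModuleCat.of R (R ⧸ Ideal.span (Set.range v))) := by
  let L : (ModuleCat.of R R ⟶ ModuleCat.of R R) →ₗ[R] R ⧸ Ideal.span (Set.range v) :=
    { toFun f := Ideal.Quotient.mk _ (f.hom 1)
      map_add' f g := by simp
      map_smul' r f := by simp [Algebra.smul_def] }
  have hL : Function.Surjective L := fun a => by
    obtain ⟨a, rfl⟩ := Ideal.Quotient.mk_surjective a
    exact ⟨ModuleCat.ofHom (LinearMap.toSpanSingleton R R a), by simp [L]⟩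
  have hker : LinearMap.range (Linear.leftComp R (ModuleCat.of R R)
      (ModuleCat.ofHom (LinearMap.toSpanSingleton R (ι → R) v))) = LinearMap.ker L := by
    classical
    ext f
    simp only [LinearMap.mem_range, LinearMap.mem_ker]
    have hLf : L f = 0 ↔ ∃ c : ι → R, ∑ i, c i * v i = f.hom 1 :=
      Ideal.Quotient.eq_zero_iff_mem.trans Ideal.mem_span_range_iff_exists_fun
    rw [hLf]
    constructor
    · rintro ⟨g, rfl⟩
      refine ⟨fun i => g.hom fun j => if i = j then 1 else 0, ?_⟩
      have := LinearMap.pi_apply_eq_sum_univ g.hom v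
      simp [this, mul_comm]
    · rintro ⟨c, hc⟩
      refine ⟨ModuleCat.ofHom (Fintype.linearCombination R c), ?_⟩
      ext
      simp [← hc, Fintype.linearCombination_apply, mul_comm]
  exact ⟨((Submodule.quotEquivOfEq _ _ hker).trans
    (L.quotKerEquivOfSurjective hL)).toModuleIso⟩

/-- The second Ext group of an ideal `(q)` whose module of relations is generated by the rows of
`D`, the rows being subject to the single relation `v`. -/
lemma nonempty_ext_two_ideal_iso {ι κ : Type} [Fintype ι] [Fintype κ] (q : κ → R)
    (D : ι → κ → R) (v : ι → R)
    (hv : Function.Injective (LinearMap.toSpanSingleton R (ι → R) v))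
    (h₁ : Function.Exact (LinearMap.toSpanSingleton R (ι → R) v) (Fintype.linearCombination R D))
    (h₀ : Function.Exact (Fintype.linearCombination R D) (Fintype.linearCombination R q)) :
    Nonempty (((Ext R (ModuleCat R) 2).obj
      (Opposite.op (ModuleCat.of R (Ideal.span (Set.range q))))).obj (ModuleCat.of R R) ≅
        ModuleCat.of R (R ⧸ Ideal.span (Set.range v))) := by
  let d₂ := ModuleCat.ofHom (LinearMap.toSpanSingleton R (ι → R) v)
  let d₁ := ModuleCat.ofHom (Fintype.linearCombination R D)
  have hq (c) : Fintype.linearCombination R q c ∈ Ideal.span (Set.range q) :=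
    Ideal.mem_span_range_iff_exists_fun.2 ⟨c, by simp [Fintype.linearCombination_apply]⟩
  let e := ModuleCat.ofHom ((Fintype.linearCombination R q).codRestrict
    (Ideal.span (Set.range q)) hq)
  have w : d₂ ≫ d₁ = 0 := ModuleCat.hom_ext h₁.linearMap_comp_eq_zero
  have h₀' : Function.Exact d₁.hom e.hom := fun c => Subtype.ext_iff.trans (h₀ c)
  have we : d₁ ≫ e = 0 := ModuleCat.hom_ext h₀'.linearMap_comp_eq_zero
  have : Mono d₂ := (ModuleCat.mono_iff_injective _).2 hv
  have : Epi e := (ModuleCat.epi_iff_surjective _).2 fun ⟨a, ha⟩ => by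
    obtain ⟨c, hc⟩ := Ideal.mem_span_range_iff_exists_fun.1 ha
    exact ⟨c, Subtype.ext ((Fintype.linearCombination_apply ..).trans hc)⟩
  obtain ⟨i⟩ := nonempty_ext_two_iso_of_resolution (R := R) d₂ d₁ e w we
    ((ShortComplex.ShortExact.moduleCat_exact_iff_function_exact _).2 h₁)
    ((ShortComplex.ShortExact.moduleCat_exact_iff_function_exact _).2 h₀')
    (ModuleCat.of R R)
  obtain ⟨j⟩ := nonempty_quotient_range_leftComp_iso v
  exact ⟨i ≪≫ j⟩

end LinearYoneda

/-- The isomorphism `Ext²(J, R) ≅ R/(x, y, F, G)` over a domain `R`, under the primality and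
non-divisibility conditions which make the module of relations of the generators of `J` explicit. -/
lemma nonempty_ext_two_of_prime {R : Type*} [CommRing R] [IsDomain R] {x y h F G A B : R}
    (hx : Prime x) (hy : Prime y)
    (hxy : ¬ x ∣ y) (hyx : ¬ y ∣ x) (hP : ¬ y ∣ x * A + h * F) (hQ : ¬ x ∣ y * B + h * G)
    (hG : ∀ a, a * G ∈ Ideal.span {x, y} → a ∈ Ideal.span {x, y}) :
    Nonempty (((Ext R (ModuleCat R) 2).obj (Opposite.op (ModuleCat.of R
      (Ideal.span {x * y, x ^ 2 * A + x * h * F, y ^ 2 * B + y * h * G,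
        x * A * G + y * B * F + h * F * G} : Ideal R)))).obj (ModuleCat.of R R) ≅
        ModuleCat.of R (R ⧸ (Ideal.span {x, y, F, G} : Ideal R))) := by
  let q : Fin 4 → R := ![x * y, x ^ 2 * A + x * h * F, y ^ 2 * B + y * h * G,
    x * A * G + y * B * F + h * F * G]
  let D : Fin 4 → Fin 4 → R := ![![B * F, G, 0, -x], ![A * G, 0, F, -y],
    ![x * A + h * F, -y, 0, 0], ![y * B + h * G, 0, -x, 0]]
  let v : Fin 4 → R := ![y, -x, G, -F]
  have hq : Ideal.span {x * y, x ^ 2 * A + x * h * F, y ^ 2 * B + y * h * G,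
      x * A * G + y * B * F + h * F * G} = Ideal.span (Set.range q) := by
    congr 1
    ext
    simp [q]
    tauto
  have hv : Ideal.span {x, y, F, G} = Ideal.span (Set.range v) := by
    apply le_antisymm <;> rw [Ideal.span_le]
    · have hmem (i) : v i ∈ Ideal.span (Set.range v) := Ideal.subset_span ⟨i, rfl⟩
      rintro _ (rfl | rfl | rfl | rfl)
      · simpa [v] using neg_mem (hmem 1)
      · exact hmem 0
      · simpa [v] using neg_mem (hmem 3)
      · exact hmem 2
    · rintro _ ⟨i, rfl⟩
      fin_cases i <;> simp only [v, Fin.reduceFinMk, Matrix.cons_val, SetLike.mem_coe,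
        neg_mem_iff] <;>
        exact Ideal.subset_span (by simp)
  rw [hq, hv]
  refine nonempty_ext_two_ideal_iso q D v ?_ ?_ ?_
  · refine (injective_iff_map_eq_zero _).2 fun a ha => ?_
    simpa [v, hy.ne_zero] using congrFun ha 0
  · intro c
    constructor
    · intro hc
      have e1 := congrFun hc 1
      have e2 := congrFun hc 2
      have e3 := congrFun hc 3
      simp [Fintype.linearCombination_apply, Fin.sum_univ_four, D] at e1 e2 e3
      obtain ⟨u, hu⟩ : y ∣ c 0 := (hy.dvd_or_dvd (a := x)
        ⟨-c 1, by linear_combination -e3⟩).resolve_left hyx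
      have h1 : c 1 = -(x * u) := mul_left_cancel₀ hy.ne_zero (by linear_combination -e3 - x * hu)
      have h2 : c 2 = G * u := mul_left_cancel₀ hy.ne_zero (by linear_combination -e1 + G * hu)
      have h3 : c 3 = -(F * u) := mul_left_cancel₀ hx.ne_zero (by linear_combination -e2 + F * h1)
      refine ⟨u, funext fun i => ?_⟩
      fin_cases i <;> simp [v, *, mul_comm]
    · rintro ⟨u, rfl⟩
      funext i
      fin_cases i <;> simp [Fintype.linearCombination_apply, Fin.sum_univ_four, D, v] <;> ring
  · intro c
    constructor
    · intro hc
      obtain ⟨p, r, s, t, h0, h1, h2, h3⟩ := exists_syzygy_coeffs hx hy hxy hyx hP hQ hG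
        (α := c 0) (β := c 1) (γ := c 2) (δ := c 3)
        (by simpa [Fintype.linearCombination_apply, Fin.sum_univ_four, q] using hc)
      refine ⟨![p, r, s, t], funext fun i => ?_⟩
      fin_cases i <;>
        simp [Fintype.linearCombination_apply, Fin.sum_univ_four, D, h0, h1, h2, h3] <;> ring
    · rintro ⟨u, rfl⟩
      simp [Fintype.linearCombination_apply, Fin.sum_univ_four, D, q]
      ring

section Variables

variable {K : Type*} [Field K]

lemma aeval_eq_self_of_mem_adjoin {σ : Type*} {s : Set σ} {v : σ → MvPolynomial σ K}
    (hv : ∀ i ∈ s, v i = X i) {p : MvPolynomial σ K}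
    (hp : p ∈ Algebra.adjoin K (X '' s : Set (MvPolynomial σ K))) : aeval v p = p := by
  have : Algebra.adjoin K (X '' s : Set (MvPolynomial σ K)) ≤
      AlgHom.equalizer (aeval v) (AlgHom.id K _) := by
    rw [Algebra.adjoin_le_iff]
    rintro _ ⟨i, hi, rfl⟩
    simpa using hv i hi
  exact this hp

lemma sub_aeval_mem {σ : Type*} {I : Ideal (MvPolynomial σ K)} {v : σ → MvPolynomial σ K}
    (hv : ∀ i, X i - v i ∈ I) (p : MvPolynomial σ K) : p - aeval v p ∈ I := by
  have : (Ideal.Quotient.mkₐ K I) = (Ideal.Quotient.mkₐ K I).comp (aeval v) := by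
    ext i
    simpa using Ideal.Quotient.eq.2 (hv i)
  exact Ideal.Quotient.eq.1 (DFunLike.congr_fun this p)

lemma mem_span_pair_of_mul_mem {g a : MvPolynomial (Fin 4) K} (hg0 : g ≠ 0)
    (hg : g ∈ Algebra.adjoin K ({X 2, X 3} : Set (MvPolynomial (Fin 4) K)))
    (h : a * g ∈ Ideal.span {(X 0 : MvPolynomial (Fin 4) K), X 1}) :
    a ∈ Ideal.span {(X 0 : MvPolynomial (Fin 4) K), X 1} := by
  let φ : MvPolynomial (Fin 4) K →ₐ[K] MvPolynomial (Fin 4) K := aeval ![0, 0, X 2, X 3]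
  have hφg : φ g = g := aeval_eq_self_of_mem_adjoin (s := {2, 3}) (by simp)
    (by rwa [Set.image_pair])
  obtain ⟨b, c, hbc⟩ := Ideal.mem_span_pair.1 h
  have h0 : φ a = 0 := by
    have := congrArg φ hbc
    rw [map_mul, hφg] at this
    simpa [hg0, φ] using this
  have := sub_aeval_mem (I := Ideal.span {(X 0 : MvPolynomial (Fin 4) K), X 1})
    (v := ![0, 0, X 2, X 3]) (fun i => by
      fin_cases i <;> simp <;> exact Ideal.subset_span (by simp)) a
  change a - φ a ∈ _ at this
  rwa [h0, sub_zero] at this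

lemma not_dvd_mul_add_mul {i j : Fin 4} (hij : j ≠ i) (hi : i ≠ 2 ∧ i ≠ 3) (hj : j ≠ 2 ∧ j ≠ 3)
    {a f h : MvPolynomial (Fin 4) K}
    (ha : a ∈ Algebra.adjoin K ({X i, X 2, X 3} : Set (MvPolynomial (Fin 4) K)))
    (hf : f ∈ Algebra.adjoin K ({X 2, X 3} : Set (MvPolynomial (Fin 4) K)))
    (hh : h ∈ Algebra.adjoin K ({X 2, X 3} : Set (MvPolynomial (Fin 4) K)))
    (hf0 : f ≠ 0) (hah : h = 0 → a ≠ 0) : ¬ X j ∣ X i * a + h * f := by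
  rintro ⟨c, hc⟩
  let φ (k : Fin 4) : MvPolynomial (Fin 4) K →ₐ[K] MvPolynomial (Fin 4) K :=
    aeval (Function.update X k 0)
  have hφX (k l : Fin 4) (hl : l ≠ k) : φ k (X l) = X l := by simp [φ, Function.update_of_ne hl]
  have hφ0 (k : Fin 4) : φ k (X k) = 0 := by simp [φ]
  have hφ (k) (hk : k ≠ 2 ∧ k ≠ 3) (g) (hg : g ∈ Algebra.adjoin K
      ({X 2, X 3} : Set (MvPolynomial (Fin 4) K))) : φ k g = g := by
    refine aeval_eq_self_of_mem_adjoin (s := {2, 3}) ?_ (by rwa [Set.image_pair])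
    simp [Function.update_of_ne hk.1.symm, Function.update_of_ne hk.2.symm]
  have hφa : φ j a = a := by
    refine aeval_eq_self_of_mem_adjoin (s := {i, 2, 3}) ?_
      (by rwa [Set.image_insert_eq, Set.image_pair])
    simp [Function.update_of_ne hj.1.symm, Function.update_of_ne hj.2.symm,
      Function.update_of_ne hij.symm]
  have h0 : X i * a + h * f = 0 := by
    simpa only [map_add, map_mul, hφa, hφ j hj f hf, hφ j hj h hh, hφX j i hij.symm, hφ0,
      zero_mul] using congrArg (φ j) hc
  have hh0 : h = 0 := by
    have := congrArg (φ i) h0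
    simp only [map_add, map_mul, hφ i hi f hf, hφ i hi h hh, hφ0, map_zero] at this
    simpa [hf0] using this
  simp [hh0, hah hh0] at h0

end Variables

/-- Isomorphism (4) in the proof of Lemma 2.2 of "The equations of space curves on a
quadric" by Di Gennaro and Nagel (ungraded version): for the ideal
`J = (xy, x²A + xhF, y²B + yhG, xAG + yBF + hFG)` one has
`Ext²_R(J, R) ≅ R/(x, y, F, G)`. -/
theorem ext_two_reducible_quadric
    (K : Type) [Field K]
    (h F G A B : MvPolynomial (Fin 4) K)
    -- h, F, G ∈ K[z,t]
    (hmem : h ∈ Algebra.adjoin K ({X 2, X 3} : Set (MvPolynomial (Fin 4) K)))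
    (Fmem : F ∈ Algebra.adjoin K ({X 2, X 3} : Set (MvPolynomial (Fin 4) K)))
    (Gmem : G ∈ Algebra.adjoin K ({X 2, X 3} : Set (MvPolynomial (Fin 4) K)))
    -- A ∈ K[x,z,t], B ∈ K[y,z,t]
    (Amem : A ∈ Algebra.adjoin K ({X 0, X 2, X 3} : Set (MvPolynomial (Fin 4) K)))
    (Bmem : B ∈ Algebra.adjoin K ({X 1, X 2, X 3} : Set (MvPolynomial (Fin 4) K)))
    -- F and G nonconstant
    (Fnc : F.totalDegree ≠ 0) (Gnc : G.totalDegree ≠ 0)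
    -- A·B ≠ 0 in case h = 0
    (hAB : h = 0 → A * B ≠ 0)
    -- the ideal J
    (J : Ideal (MvPolynomial (Fin 4) K))
    (hJ : J = Ideal.span {X 0 * X 1, X 0 ^ 2 * A + X 0 * h * F,
      X 1 ^ 2 * B + X 1 * h * G, X 0 * A * G + X 1 * B * F + h * F * G}) :
    Nonempty
      ((((Ext (MvPolynomial (Fin 4) K) (ModuleCat (MvPolynomial (Fin 4) K)) 2).obj
          (Opposite.op (ModuleCat.of (MvPolynomial (Fin 4) K) J))).obj
          (ModuleCat.of (MvPolynomial (Fin 4) K) (MvPolynomial (Fin 4) K))) ≅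
        ModuleCat.of (MvPolynomial (Fin 4) K)
          (MvPolynomial (Fin 4) K ⧸ (Ideal.span {X 0, X 1, F, G} :
            Ideal (MvPolynomial (Fin 4) K)))) := by
  have hF0 : F ≠ 0 := fun h0 => Fnc (by simp [h0])
  have hG0 : G ≠ 0 := fun h0 => Gnc (by simp [h0])
  have hP : ¬ (X 1 : MvPolynomial (Fin 4) K) ∣ X 0 * A + h * F :=
    not_dvd_mul_add_mul (by decide) (by decide) (by decide) Amem Fmem hmem hF0
      fun h0 => left_ne_zero_of_mul (hAB h0)
  have hQ : ¬ (X 0 : MvPolynomial (Fin 4) K) ∣ X 1 * B + h * G :=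
    not_dvd_mul_add_mul (by decide) (by decide) (by decide) Bmem Gmem hmem hG0
      fun h0 => right_ne_zero_of_mul (hAB h0)
  obtain ⟨i⟩ := nonempty_ext_two_of_prime X_prime X_prime (by simp [X_dvd_X]) (by simp [X_dvd_X])
    hP hQ (fun a => mem_span_pair_of_mul_mem hG0 Gmem)
  subst hJ
  exact ⟨i⟩
end

section
/- Let K be a field, R = K[x,y,z,t], and let d ≥ 2 be an integer. Then the ideal I_d = (xz − yt) + (x,y)^d of R cannot be generated by d+1 elements; that is, there is no set S ⊆ R with |S| ≤ d+1 and Ideal.span S = I_d (so I_d has exactly d+2 minimal generators, namely xz − yt and the d+1 monomials x^d, x^{d−1}y, …, y^d). -/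
open MvPolynomial

section MultipleLine

variable {K : Type*} [Field K]

/-- A polynomial in `(x, y) ^ k` has no monomials of degree less than `k` in `x, y`. -/
theorem coeff_eq_zero_of_mem_span_pair_pow (k : ℕ) {f : MvPolynomial (Fin 4) K}
    (hf : f ∈ (Ideal.span {X 0, X 1} : Ideal (MvPolynomial (Fin 4) K)) ^ k)
    {n : Fin 4 →₀ ℕ} (hn : n 0 + n 1 < k) : coeff n f = 0 := by
  induction k generalizing f n with
  | zero => omega
  | succ k ih =>
    rw [pow_succ] at hf
    induction hf using Submodule.mul_induction_on' with
    | add f _ g _ hf hg => rw [coeff_add, hf, hg, add_zero]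
    | mem_mul_mem f hf g hg =>
      obtain ⟨a, b, rfl⟩ := Ideal.mem_span_pair.mp hg
      have key (i : Fin 4) (hi : i = 0 ∨ i = 1) (c : MvPolynomial (Fin 4) K) :
          coeff n (f * c * X i) = 0 := by
        rw [coeff_mul_X']
        split_ifs with h
        · refine ih (Ideal.mul_mem_right _ _ hf) ?_
          rw [Finsupp.mem_support_iff] at h
          rcases hi with rfl | rfl <;> simp <;> omega
        · rfl
      rw [mul_add, ← mul_assoc, ← mul_assoc, coeff_add, key 0 (.inl rfl), key 1 (.inr rfl),
        add_zero]

theorem quadric_eq_monomial_sub_monomial :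
    (X 0 * X 2 - X 1 * X 3 : MvPolynomial (Fin 4) K) =
      monomial (Finsupp.single 0 1 + Finsupp.single 2 1) 1 -
        monomial (Finsupp.single 1 1 + Finsupp.single 3 1) 1 := by
  simp [X, monomial_mul]

/-- A multiple of `xz - yt` only has monomials divisible by `xz` or by `yt`. -/
theorem coeff_mul_quadric_eq_zero (f : MvPolynomial (Fin 4) K) {n : Fin 4 →₀ ℕ}
    (h₁ : n 0 = 0 ∨ n 2 = 0) (h₂ : n 1 = 0 ∨ n 3 = 0) :
    coeff n (f * (X 0 * X 2 - X 1 * X 3)) = 0 := by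
  rw [quadric_eq_monomial_sub_monomial, mul_sub, coeff_sub, coeff_mul_monomial',
    coeff_mul_monomial', if_neg, if_neg, sub_zero]
  · intro h
    have h1 := h 1
    have h3 := h 3
    simp at h1 h3
    omega
  · intro h
    have h0 := h 0
    have h2 := h 2
    simp at h0 h2
    omega

/-- The ideal `(xz - yt) + (x, y) ^ d`. -/
noncomputable abbrev multipleLineIdeal (K : Type*) [Field K] (d : ℕ) :
    Ideal (MvPolynomial (Fin 4) K) :=
  Ideal.span {X 0 * X 2 - X 1 * X 3} + (Ideal.span {X 0, X 1}) ^ d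

theorem coeff_eq_zero_of_mem_multipleLineIdeal {d : ℕ} {f : MvPolynomial (Fin 4) K}
    (hf : f ∈ multipleLineIdeal K d) {n : Fin 4 →₀ ℕ} (hn : n 0 + n 1 < d)
    (h₁ : n 0 = 0 ∨ n 2 = 0) (h₂ : n 1 = 0 ∨ n 3 = 0) : coeff n f = 0 := by
  obtain ⟨g, hg, h, hh, rfl⟩ := Submodule.mem_sup.mp hf
  obtain ⟨a, rfl⟩ := Ideal.mem_span_singleton'.mp hg
  rw [coeff_add, coeff_mul_quadric_eq_zero a h₁ h₂, coeff_eq_zero_of_mem_span_pair_pow d hh hn,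
    add_zero]

/-- If all coefficients of `f` strictly below `m` vanish, then the coefficient of `r * f` at `m`
is the constant coefficient of `r` times the coefficient of `f` at `m`. -/
theorem coeff_mul_of_forall_lt_coeff_eq_zero {σ R : Type*} [CommSemiring R] {m : σ →₀ ℕ}
    (r : MvPolynomial σ R) {f : MvPolynomial σ R} (hf : ∀ n < m, coeff n f = 0) :
    coeff m (r * f) = constantCoeff r * coeff m f := by
  classical
  rw [coeff_mul, Finset.sum_eq_single (0, m), constantCoeff_eq]
  · rintro ⟨a, b⟩ hab hne
    rw [Finset.HasAntidiagonal.mem_antidiagonal] at hab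
    dsimp only at hab ⊢
    rw [hf b, mul_zero]
    refine lt_of_le_of_ne (hab ▸ le_add_self) ?_
    rintro rfl
    exact hne (by simpa using hab)
  · simp

/-- The exponents of `xz` and of the monomials `x ^ i * y ^ (d - i)`. -/
noncomputable def generatorExponent (d : ℕ) : Option (Fin (d + 1)) → Fin 4 →₀ ℕ
  | none => Finsupp.single 0 1 + Finsupp.single 2 1
  | some i => Finsupp.single 0 (i : ℕ) + Finsupp.single 1 (d - i)

theorem generatorExponent_injective (d : ℕ) : Function.Injective (generatorExponent d) := by
  rintro (_ | i) (_ | j) h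
  · rfl
  · simpa [generatorExponent] using DFunLike.congr_fun h 2
  · simpa [generatorExponent] using DFunLike.congr_fun h 2
  · have := DFunLike.congr_fun h 0
    simp [generatorExponent] at this
    rw [Fin.ext this]

/-- The coefficients of a polynomial at `xz` and at the monomials `x ^ i * y ^ (d - i)`. -/
noncomputable def generatorCoeff (K : Type*) [Field K] (d : ℕ) :
    MvPolynomial (Fin 4) K →ₗ[K] (Option (Fin (d + 1)) → K) :=
  LinearMap.pi fun j ↦ lcoeff K (generatorExponent d j)

theorem generatorCoeff_apply {d : ℕ} (f : MvPolynomial (Fin 4) K) (j : Option (Fin (d + 1))) :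
    generatorCoeff K d f j = coeff (generatorExponent d j) f := rfl

theorem generatorCoeff_mul {d : ℕ} (hd : 2 ≤ d) (r : MvPolynomial (Fin 4) K)
    {f : MvPolynomial (Fin 4) K} (hf : f ∈ multipleLineIdeal K d) :
    generatorCoeff K d (r * f) = constantCoeff r • generatorCoeff K d f := by
  ext j
  refine coeff_mul_of_forall_lt_coeff_eq_zero r fun n hn ↦ ?_
  obtain ⟨hle, i, hi⟩ := Finsupp.lt_def.mp hn
  have h0 := hle 0
  have h1 := hle 1
  have h2 := hle 2
  have h3 := hle 3
  apply coeff_eq_zero_of_mem_multipleLineIdeal hf <;>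
  rcases j with _ | j <;> fin_cases i <;>
  simp [generatorExponent] at h0 h1 h2 h3 hi ⊢ <;> omega

theorem exists_mem_generatorCoeff_eq_single (d : ℕ) (j : Option (Fin (d + 1))) :
    ∃ f ∈ multipleLineIdeal K d, generatorCoeff K d f = Pi.single j 1 := by
  classical
  have hmon (i j : Option (Fin (d + 1))) :
      coeff (generatorExponent d i) (monomial (generatorExponent d j) (1 : K)) =
        (Pi.single j 1 : Option (Fin (d + 1)) → K) i := by
    simp [coeff_monomial, Pi.single_apply, (generatorExponent_injective d).eq_iff, eq_comm]
  rcases j with _ | j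
  · refine ⟨X 0 * X 2 - X 1 * X 3, Submodule.mem_sup_left (Ideal.mem_span_singleton_self _), ?_⟩
    ext i
    rw [generatorCoeff_apply, quadric_eq_monomial_sub_monomial, coeff_sub, ← hmon i none,
      coeff_monomial (m := generatorExponent d i) (n := Finsupp.single 1 1 + Finsupp.single 3 1),
      if_neg, sub_zero]
    · rfl
    · intro h
      have := DFunLike.congr_fun h 3
      rcases i with _ | i <;> simp [generatorExponent] at this
  · refine ⟨monomial (generatorExponent d (some j)) 1, Submodule.mem_sup_right ?_,
      funext fun i ↦ hmon i _⟩
    have : (monomial (generatorExponent d (some j)) 1 : MvPolynomial (Fin 4) K) =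
        X 0 ^ (j : ℕ) * X 1 ^ (d - j) := by
      simp [generatorExponent, X_pow_eq_monomial, monomial_mul]
    have hj : d = (j : ℕ) + (d - j) := by omega
    rw [this, congrArg ((Ideal.span {X 0, X 1} : Ideal (MvPolynomial (Fin 4) K)) ^ ·) hj, pow_add]
    exact Ideal.mul_mem_mul (Ideal.pow_mem_pow (Ideal.subset_span (by simp)) _)
      (Ideal.pow_mem_pow (Ideal.subset_span (by simp)) _)

end MultipleLine

/-- The minimality assertion of Lemma 3.1 of "The equations of space curves on a
quadric" by Di Gennaro and Nagel: for `d ≥ 2` the ideal `I_d = (xz - yt) + (x,y)^d`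
cannot be generated by `d + 1` elements (it has exactly `d + 2` minimal generators). -/
theorem minimal_generators_multiple_line_smooth_quadric
    {K : Type*} [Field K] (d : ℕ) (hd : 2 ≤ d) :
    ¬ ∃ S : Finset (MvPolynomial (Fin 4) K), S.card ≤ d + 1 ∧
      Ideal.span (S : Set (MvPolynomial (Fin 4) K)) =
        Ideal.span {X 0 * X 2 - X 1 * X 3} +
          (Ideal.span {X 0, X 1} : Ideal (MvPolynomial (Fin 4) K)) ^ d := by
  classical
  rintro ⟨S, hcard, hS⟩
  change _ = multipleLineIdeal K d at hS
  have hmem : ∀ f ∈ Ideal.span (S : Set (MvPolynomial (Fin 4) K)),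
      generatorCoeff K d f ∈ Submodule.span K (S.image (generatorCoeff K d) : Set _) := by
    intro f hf
    induction hf using Submodule.span_induction with
    | mem f hf => exact Submodule.subset_span (Finset.mem_coe.mpr (Finset.mem_image_of_mem _ hf))
    | zero => simp
    | add f g _ _ hf hg => simpa using add_mem hf hg
    | smul r f hf ih =>
      rw [smul_eq_mul, generatorCoeff_mul hd r (hS ▸ hf)]
      exact Submodule.smul_mem _ _ ih
  have htop : Submodule.span K (S.image (generatorCoeff K d) : Set (Option (Fin (d + 1)) → K)) =
      ⊤ := by
    rw [eq_top_iff, ← (Pi.basisFun K _).span_eq, Submodule.span_le]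
    rintro _ ⟨j, rfl⟩
    obtain ⟨f, hf, hfj⟩ := exists_mem_generatorCoeff_eq_single (K := K) d j
    rw [Pi.basisFun_apply, ← hfj]
    exact hmem f (hS ▸ hf)
  have hle := finrank_span_finset_le_card (R := K) (S.image (generatorCoeff K d))
  rw [Set.finrank, htop, finrank_top, Module.finrank_fintype_fun_eq_card, Fintype.card_option,
    Fintype.card_fin] at hle
  have := Finset.card_image_le (s := S) (f := generatorCoeff K d)
  omega
end

section
/- Let K be a field, R = K[x,y,z,t], and let d ≥ 2 be an integer. Let N_d be the d×(d−1) matrix over R with (N_d)_{j,j} = z, (N_d)_{j+1,j} = −t (1 ≤ j ≤ d−1) and zeros elsewhere, and let M_d be the d×(d−1) matrix with (M_d)_{j,j} = y, (M_d)_{j+1,j} = −x and zeros elsewhere. Let I_d = (xz − yt) + (x,y)^d, regarded as an R-module. Then Ext²_R(I_d, R) is isomorphic as an R-module to the cokernel of the map R^{2d} → R^{d−1} given by the (d−1)×(2d) block matrix [N_dᵀ , −M_dᵀ]. -/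
open MvPolynomial CategoryTheory

section
open ZeroObject Limits
variable {C : Type*} [Category* C] [Abelian C] {P₀ P₁ P₂ Z : C}

/-- The chain complex `⋯ ⟶ 0 ⟶ P₂ ⟶ P₁ ⟶ P₀`. -/
noncomputable def ChainComplex.ofThree (f : P₂ ⟶ P₁) (g : P₁ ⟶ P₀) (w : f ≫ g = 0) :
    ChainComplex C ℕ where
  X n := match n with
    | 0 => P₀
    | 1 => P₁
    | 2 => P₂
    | _ + 3 => 0
  d i j := match i, j with
    | 1, 0 => g
    | 2, 1 => f
    | _, _ => 0
  shape i j h := by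
    split
    · simp at h
    · simp at h
    · rfl
  d_comp_d' i j k hij hjk := by
    obtain rfl : k + 1 = j := hjk
    obtain rfl : k + 1 + 1 = i := hij
    obtain _ | k := k
    · exact w
    · exact zero_comp

/-- An exact sequence `0 ⟶ P₂ ⟶ P₁ ⟶ P₀ ⟶ Z ⟶ 0` with `P₀`, `P₁`, `P₂` projective, as a
projective resolution of `Z`. -/
noncomputable def CategoryTheory.ProjectiveResolution.ofThree
    [Projective P₀] [Projective P₁] [Projective P₂]
    (f : P₂ ⟶ P₁) (g : P₁ ⟶ P₀) (h : P₀ ⟶ Z) [Mono f] [Epi h]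
    (w : f ≫ g = 0) (w' : g ≫ h = 0) (e₁ : (ShortComplex.mk f g w).Exact)
    (e₀ : (ShortComplex.mk g h w').Exact) : ProjectiveResolution Z where
  complex := ChainComplex.ofThree f g w
  projective n := by
    obtain (_ | _ | _ | n) := n
    · exact (inferInstance : Projective P₀)
    · exact (inferInstance : Projective P₁)
    · exact (inferInstance : Projective P₂)
    · exact (inferInstance : Projective (0 : C))
  π := (ChainComplex.toSingle₀Equiv _ _).symm ⟨h, w'⟩
  quasiIso := ⟨fun n => by
    cases n
    · rw [ChainComplex.quasiIsoAt₀_iff, ShortComplex.quasiIso_iff_of_zeros']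
      · refine (ShortComplex.exact_and_epi_g_iff_of_iso (S₂ := ShortComplex.mk g h w') ?_).2
          ⟨e₀, ‹Epi h›⟩
        exact ShortComplex.isoMk (Iso.refl _) (Iso.refl _) (Iso.refl _)
          ((Category.id_comp _).trans (Category.comp_id _).symm)
          ((Category.id_comp h).trans ((ChainComplex.toSingle₀Equiv_symm_apply_f_zero
            (C := ChainComplex.ofThree f g w) h w').symm.trans
              (Category.comp_id (X := P₀) (Y := Z) _).symm))
      all_goals rfl
    · rename_i n
      rw [quasiIsoAt_iff_exactAt']
      · rw [HomologicalComplex.exactAt_iff' _ (n + 1 + 1) (n + 1) n (by simp) (by simp)]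
        obtain _ | _ | n := n
        · exact e₁
        · exact (ShortComplex.exact_iff_mono _ rfl).2 ‹Mono f›
        · exact ShortComplex.exact_of_isZero_X₂ _ (isZero_zero C)
      · apply ChainComplex.exactAt_succ_single_obj⟩

end

universe u

/-- `Ext²(M, N)` is the cokernel of `Hom(P₁, N) → Hom(P₂, N)` for a projective resolution
`0 → P₂ → P₁ → P₀ → M → 0`. -/
lemma nonempty_ext_two_iso {R : Type u} [CommRing R] {P₀ P₁ P₂ M : Type u}
    [AddCommGroup P₀] [AddCommGroup P₁] [AddCommGroup P₂] [AddCommGroup M]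
    [Module R P₀] [Module R P₁] [Module R P₂] [Module R M]
    [Module.Projective R P₀] [Module.Projective R P₁] [Module.Projective R P₂]
    (f : P₂ →ₗ[R] P₁) (g : P₁ →ₗ[R] P₀) (h : P₀ →ₗ[R] M)
    (hf : Function.Injective f) (hfg : Function.Exact f g) (hgh : Function.Exact g h)
    (hh : Function.Surjective h) (N : Type u) [AddCommGroup N] [Module R N] :
    Nonempty ((((Ext R (ModuleCat.{u} R) 2).obj (Opposite.op (ModuleCat.of R M))).obj
      (ModuleCat.of R N)) ≅ ModuleCat.of R ((P₂ →ₗ[R] N) ⧸ LinearMap.range (f.lcomp R N))) := by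
  have : Mono (ModuleCat.ofHom f) := (ModuleCat.mono_iff_injective _).2 hf
  have : Epi (ModuleCat.ofHom h) := (ModuleCat.epi_iff_surjective _).2 hh
  let P := ProjectiveResolution.ofThree (ModuleCat.ofHom f) (ModuleCat.ofHom g)
    (ModuleCat.ofHom h) (by ext x; exact hfg.apply_apply_eq_zero x)
    (by ext x; exact hgh.apply_apply_eq_zero x)
    ((ShortComplex.moduleCat_exact_iff _).2 fun x hx => (hfg x).1 hx)
    ((ShortComplex.moduleCat_exact_iff _).2 fun x hx => (hgh x).1 hx)
  let Q := P.complex.linearYonedaObj R (ModuleCat.of R N)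
  let S := Q.sc' 1 2 3
  let e : Q.homology 2 ≅ S.homology :=
    ShortComplex.homologyMapIso (Q.isoSc' 1 2 3 (by simp) (by simp))
  have hg₀ : S.g = 0 := by
    ext φ : 2
    exact Limits.zero_comp (f := φ)
  let e' := (ShortComplex.LeftHomologyData.ofIsColimitCokernelCofork S hg₀ _
    (ModuleCat.cokernelIsColimit S.f)).homologyIso
  refine ⟨P.isoExt 2 (ModuleCat.of R N) ≪≫ e ≪≫ e' ≪≫ ?_⟩
  let eq : S.X₂ ≃ₗ[R] (P₂ →ₗ[R] N) :=
    ModuleCat.homLinearEquiv (S := R) (M := ModuleCat.of R P₂) (N := ModuleCat.of R N)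
  refine LinearEquiv.toModuleIso (Submodule.Quotient.equiv _ _ eq ?_)
  ext φ
  constructor
  · rintro ⟨_, ⟨ψ, rfl⟩, rfl⟩
    exact ⟨(show ModuleCat.of R P₁ ⟶ ModuleCat.of R N from ψ).hom, rfl⟩
  · rintro ⟨ψ, rfl⟩
    exact ⟨_, ⟨ModuleCat.ofHom ψ, rfl⟩, rfl⟩

section BinaryForms

variable {R : Type*} [CommRing R]

/-- Multiplication by `u`, where `f : Fin n → R` stands for the binary form
`∑ i, f i • u ^ (n - 1 - i) * v ^ i`. -/
def snocZero (R : Type*) [CommRing R] (n : ℕ) : (Fin n → R) →ₗ[R] (Fin (n + 1) → R) where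
  toFun f := Fin.snoc (α := fun _ => R) f 0
  map_add' f g := by
    ext i; refine Fin.lastCases ?_ (fun j => ?_) i <;> simp
  map_smul' c f := by
    ext i; refine Fin.lastCases ?_ (fun j => ?_) i <;> simp

/-- Multiplication by `v` of a binary form. -/
def consZero (R : Type*) [CommRing R] (n : ℕ) : (Fin n → R) →ₗ[R] (Fin (n + 1) → R) where
  toFun f := Fin.cons (α := fun _ => R) 0 f
  map_add' f g := by
    ext i; refine Fin.cases ?_ (fun j => ?_) i <;> simp
  map_smul' c f := by
    ext i; refine Fin.cases ?_ (fun j => ?_) i <;> simp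

@[simp]
lemma snocZero_last (n : ℕ) (f : Fin n → R) : snocZero R n f (Fin.last n) = 0 :=
  Fin.snoc_last (α := fun _ => R) 0 f

@[simp]
lemma snocZero_castSucc (n : ℕ) (f : Fin n → R) (i : Fin n) :
    snocZero R n f i.castSucc = f i :=
  Fin.snoc_castSucc (α := fun _ => R) 0 f i

@[simp]
lemma consZero_zero (n : ℕ) (f : Fin n → R) : consZero R n f 0 = 0 := rfl

@[simp]
lemma consZero_succ (n : ℕ) (f : Fin n → R) (i : Fin n) : consZero R n f i.succ = f i := rfl

lemma snocZero_single (n : ℕ) (i : Fin n) (c : R) :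
    snocZero R n (Pi.single i c) = Pi.single i.castSucc c := by
  ext j
  refine Fin.lastCases ?_ (fun j => ?_) j
  · simp [(Fin.castSucc_ne_last i).symm]
  · simp [Pi.single_apply]

lemma consZero_single (n : ℕ) (i : Fin n) (c : R) :
    consZero R n (Pi.single i c) = Pi.single i.succ c := by
  ext j
  refine Fin.cases ?_ (fun j => ?_) j
  · simp [(Fin.succ_ne_zero i).symm]
  · simp [Pi.single_apply]

/-- Multiplication by `a * u + b * v` of a binary form. -/
def mulLinear (a b : R) (n : ℕ) : (Fin n → R) →ₗ[R] (Fin (n + 1) → R) :=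
  a • snocZero R n + b • consZero R n

/-- The value at `(x, y)` of a binary form. -/
def evalForm (x y : R) (n : ℕ) : (Fin n → R) →ₗ[R] R :=
  ∑ i : Fin n, (x ^ (n - 1 - i) * y ^ (i : ℕ)) • LinearMap.proj i

lemma evalForm_apply (x y : R) (n : ℕ) (f : Fin n → R) :
    evalForm x y n f = ∑ i : Fin n, x ^ (n - 1 - i) * y ^ (i : ℕ) * f i := by
  simp [evalForm]

lemma mulLinear_apply (a b : R) (n : ℕ) (f : Fin n → R) :
    mulLinear a b n f = a • snocZero R n f + b • consZero R n f := rfl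

lemma snocZero_consZero (n : ℕ) (f : Fin n → R) :
    snocZero R (n + 1) (consZero R n f) = consZero R (n + 1) (snocZero R n f) :=
  (Fin.cons_snoc_eq_snoc_cons (β := R) 0 f 0).symm

lemma mulLinear_comm (a b a' b' : R) (n : ℕ) (f : Fin n → R) :
    mulLinear a b (n + 1) (mulLinear a' b' n f) =
      mulLinear a' b' (n + 1) (mulLinear a b n f) := by
  simp only [mulLinear_apply, map_add, map_smul, snocZero_consZero]
  module

lemma snocZero_mulLinear (a b : R) (n : ℕ) (f : Fin n → R) :
    snocZero R (n + 1) (mulLinear a b n f) = mulLinear a b (n + 1) (snocZero R n f) := by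
  simp only [mulLinear_apply, map_add, map_smul, snocZero_consZero]

lemma evalForm_snocZero (x y : R) (n : ℕ) (f : Fin n → R) :
    evalForm x y (n + 1) (snocZero R n f) = x * evalForm x y n f := by
  simp only [evalForm_apply, Fin.sum_univ_castSucc, Finset.mul_sum]
  simp only [snocZero_castSucc, snocZero_last, mul_zero, add_zero, Fin.val_castSucc]
  refine Finset.sum_congr rfl fun i _ => ?_
  rw [show n + 1 - 1 - (i : ℕ) = n - 1 - i + 1 by lia]
  ring

lemma evalForm_consZero (x y : R) (n : ℕ) (f : Fin n → R) :
    evalForm x y (n + 1) (consZero R n f) = y * evalForm x y n f := by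
  simp only [evalForm_apply, Fin.sum_univ_succ, Finset.mul_sum]
  simp only [consZero_succ, consZero_zero, mul_zero, zero_add, Fin.val_succ]
  refine Finset.sum_congr rfl fun i _ => ?_
  rw [show n + 1 - 1 - ((i : ℕ) + 1) = n - 1 - i by lia]
  ring

lemma evalForm_mulLinear (x y a b : R) (n : ℕ) (f : Fin n → R) :
    evalForm x y (n + 1) (mulLinear a b n f) = (a * x + b * y) * evalForm x y n f := by
  simp only [mulLinear_apply, map_add, map_smul, evalForm_snocZero, evalForm_consZero,
    smul_eq_mul]
  ring

/-- A form that vanishes at `(x, y)` is divisible by `y * u - x * v` when `x`, `y` is a regular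
sequence. -/
lemma exists_mulLinear_of_evalForm_eq_zero {x y : R} (hx : IsLeftRegular x)
    (hxy : ∀ a, x ∣ y * a → x ∣ a) (n : ℕ) (f : Fin (n + 1) → R)
    (hf : evalForm x y (n + 1) f = 0) : ∃ g, mulLinear y (-x) n g = f := by
  have key (k : ℕ) (a : R) (h : x ∣ y ^ k * a) : x ∣ a := by
    induction k with
    | zero => simpa using h
    | succ k ih => exact ih (hxy _ (by rwa [← mul_assoc, ← pow_succ']))
  induction n with
  | zero =>
    refine ⟨0, ?_⟩
    ext i
    rw [map_zero, Fin.fin_one_eq_zero i]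
    simpa [evalForm_apply] using hf.symm
  | succ n ih =>
    obtain ⟨b, hb⟩ : x ∣ f (Fin.last (n + 1)) := by
      apply key (n + 1)
      rw [evalForm_apply, Fin.sum_univ_castSucc] at hf
      rw [show y ^ (n + 1) * f (Fin.last (n + 1)) = - ∑ i : Fin (n + 1),
        x ^ (n + 1 + 1 - 1 - (i.castSucc : ℕ)) * y ^ (i.castSucc : ℕ) * f i.castSucc by
          rw [eq_neg_iff_add_eq_zero, ← hf, add_comm]; simp]
      refine (Finset.dvd_sum fun i _ => ?_).neg_right
      rw [mul_assoc]
      exact (dvd_pow_self _ (by simp; lia)).mul_right _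
    let m : Fin (n + 1) → R := Pi.single (Fin.last n) b
    let p := f + mulLinear y (-x) (n + 1) m
    have hp : snocZero R (n + 1) (Fin.init p) = p := by
      have hlast : p (Fin.last (n + 1)) = 0 := by
        simp [p, m, hb, mulLinear_apply, consZero_single]
      change Fin.snoc (Fin.init p) 0 = p
      rw [← hlast, Fin.snoc_init_self]
    have hev : evalForm x y (n + 1) (Fin.init p) = 0 := by
      apply hx
      change x * _ = x * 0
      rw [← evalForm_snocZero, hp]
      simp only [p, map_add, hf, evalForm_mulLinear]
      ring
    obtain ⟨g, hg⟩ := ih _ hev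
    refine ⟨snocZero R n g - m, ?_⟩
    rw [map_sub, ← snocZero_mulLinear, hg, hp]
    simp [p]

/-- Modulo a prime ideal `P`, multiplication by `a * u + b * v` with `a ∉ P`
is injective. -/
lemma mem_of_mulLinear_mem {P : Ideal R} [P.IsPrime] {a b : R} (ha : a ∉ P) (n : ℕ)
    (f : Fin n → R) (hf : ∀ i, mulLinear a b n f i ∈ P) (i : Fin n) : f i ∈ P := by
  have h := hf i.castSucc
  obtain ⟨i, hi⟩ := i
  induction i with
  | zero =>
    obtain _ | n := n
    · lia
    have h₀ : consZero R (n + 1) f (Fin.castSucc ⟨0, hi⟩) = 0 := rfl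
    simp only [mulLinear_apply, Pi.add_apply, Pi.smul_apply, snocZero_castSucc, smul_eq_mul, h₀,
      mul_zero, add_zero] at h
    exact (Ideal.IsPrime.mem_or_mem ‹_› h).resolve_left ha
  | succ i ih =>
    have h₀ : consZero R n f (Fin.castSucc ⟨i + 1, hi⟩) = f ⟨i, by lia⟩ := rfl
    simp only [mulLinear_apply, Pi.add_apply, Pi.smul_apply, snocZero_castSucc, smul_eq_mul,
      h₀] at h
    have := (Ideal.add_mem_iff_left _ (P.mul_mem_left b (ih (by lia) (hf _)))).1 h
    exact (Ideal.IsPrime.mem_or_mem ‹_› this).resolve_left ha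

lemma mulLinear_injective [IsDomain R] {a : R} (ha : a ≠ 0) (b : R) (n : ℕ) :
    Function.Injective (mulLinear a b n) := by
  rw [injective_iff_map_eq_zero]
  intro f hf
  ext i
  exact mem_of_mulLinear_mem (P := ⊥) (b := b) ha n f (fun j => by simp [hf]) i

lemma evalForm_mem (x y : R) (P : Ideal R) (n : ℕ) (f : Fin (n + 1) → R) (hf : ∀ i, f i ∈ P) :
    evalForm x y (n + 1) f ∈ Ideal.span {x, y} ^ n * P := by
  rw [evalForm_apply]
  refine Ideal.sum_mem _ fun i _ => Ideal.mul_mem_mul ?_ (hf i)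
  have hx : x ∈ Ideal.span {x, y} := Ideal.subset_span (by simp)
  have hy : y ∈ Ideal.span {x, y} := Ideal.subset_span (by simp)
  have h := Ideal.mul_mem_mul (Ideal.pow_mem_pow hx (n + 1 - 1 - i)) (Ideal.pow_mem_pow hy i)
  rwa [← pow_add, show n + 1 - 1 - (i : ℕ) + i = n by lia] at h

lemma range_evalForm (x y : R) (n : ℕ) :
    LinearMap.range (evalForm x y (n + 1)) = Ideal.span {x, y} ^ n := by
  apply le_antisymm
  · rintro _ ⟨f, rfl⟩
    simpa using evalForm_mem x y ⊤ n f (by simp)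
  · induction n with
    | zero =>
      intro c _
      exact ⟨fun _ => c, by simp [evalForm_apply]⟩
    | succ n ih =>
      rw [pow_succ', Ideal.mul_le]
      intro r hr s hs
      obtain ⟨a, b, rfl⟩ := Ideal.mem_span_pair.1 hr
      obtain ⟨f, rfl⟩ := ih hs
      exact ⟨mulLinear a b (n + 1) f, evalForm_mulLinear x y a b (n + 1) f⟩

/-- A form of degree `n` whose value at a regular sequence `x`, `y` lies in `(x, y) ^ (n + 1)` has
its coefficients in `(x, y)`. -/
lemma mem_span_of_evalForm_mem {x y : R} (hx : IsLeftRegular x)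
    (hxy : ∀ a, x ∣ y * a → x ∣ a) (n : ℕ) (f : Fin (n + 1) → R)
    (hf : evalForm x y (n + 1) f ∈ Ideal.span {x, y} ^ (n + 1)) (i : Fin (n + 1)) :
    f i ∈ Ideal.span {x, y} := by
  rw [← range_evalForm] at hf
  obtain ⟨g, hg⟩ := hf
  have hsplit : g = snocZero R (n + 1) (Fin.init g) +
      consZero R (n + 1) (Pi.single (Fin.last n) (g (Fin.last (n + 1)))) := by
    ext j
    refine Fin.lastCases ?_ (fun j => ?_) j
    · simp [consZero_single]
    · simp [consZero_single, Fin.init]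
  set g₁ := Fin.init g
  set g₂ : Fin (n + 1) → R := Pi.single (Fin.last n) (g (Fin.last (n + 1)))
  obtain ⟨p, hp⟩ := exists_mulLinear_of_evalForm_eq_zero hx hxy n (f - (x • g₁ + y • g₂)) (by
    rw [map_sub, ← hg, hsplit, map_add, evalForm_snocZero, evalForm_consZero]
    simp)
  rw [eq_sub_iff_add_eq] at hp
  rw [← hp, Ideal.mem_span_pair]
  refine ⟨g₁ i - consZero R n p i, g₂ i + snocZero R n p i, ?_⟩
  simp only [mulLinear_apply, Pi.add_apply, Pi.smul_apply, smul_eq_mul]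
  ring

/-- Multiplication by `x * z - y * t` on the associated graded ring of `(x, y)` is injective. -/
lemma mem_pow_of_mul_mem_pow {x y z t : R} (hx : IsLeftRegular x)
    (hxy : ∀ a, x ∣ y * a → x ∣ a) [(Ideal.span {x, y}).IsPrime] (hz : z ∉ Ideal.span {x, y})
    (n : ℕ) (c : R) (hc : c * (x * z - y * t) ∈ Ideal.span {x, y} ^ (n + 1)) :
    c ∈ Ideal.span {x, y} ^ n := by
  induction n with
  | zero => simp
  | succ n ih =>
    have hc' := ih (Ideal.pow_le_pow_right (by lia) hc)
    rw [← range_evalForm] at hc'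
    obtain ⟨f, rfl⟩ := hc'
    refine evalForm_mem x y _ n f (mem_of_mulLinear_mem (b := -t) hz _ f fun i =>
      mem_span_of_evalForm_mem hx hxy (n + 1) _ ?_ i)
    rw [evalForm_mulLinear]
    convert hc using 1
    ring

/-- The second syzygy map in the resolution of `(x * z - y * t) + (x, y) ^ n`. -/
def syzygyTwo (x y z t : R) (n : ℕ) :
    (Fin n → R) →ₗ[R] (Fin (n + 1) → R) × (Fin (n + 1) → R) :=
  (mulLinear z (-t) n).prod (-mulLinear y (-x) n)

/-- The first syzygy map in the resolution of `(x * z - y * t) + (x, y) ^ n`. -/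
def syzygyOne (x y z t : R) (n : ℕ) :
    (Fin n → R) × (Fin n → R) →ₗ[R] (Fin (n + 1) → R) × R :=
  ((mulLinear y (-x) n).prod 0).coprod ((mulLinear z (-t) n).prod (-evalForm x y n))

/-- The generators of `(x * z - y * t) + (x, y) ^ n`. -/
def generatorsMap (x y z t : R) (n : ℕ) : (Fin (n + 1) → R) × R →ₗ[R] R :=
  (evalForm x y (n + 1)).coprod (LinearMap.mulRight R (x * z - y * t))

lemma range_generatorsMap (x y z t : R) (n : ℕ) :
    LinearMap.range (generatorsMap x y z t n) =
      Ideal.span {x * z - y * t} + Ideal.span {x, y} ^ n := by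
  rw [generatorsMap, LinearMap.range_coprod, range_evalForm, Submodule.add_eq_sup, sup_comm]
  congr 1
  ext c
  simp [Ideal.mem_span_singleton', eq_comm]

lemma exact_syzygyOne_generatorsMap {x y z t : R} (hx : IsLeftRegular x)
    (hxy : ∀ a, x ∣ y * a → x ∣ a) [(Ideal.span {x, y}).IsPrime] (hz : z ∉ Ideal.span {x, y})
    (n : ℕ) : Function.Exact (syzygyOne x y z t (n + 1)) (generatorsMap x y z t (n + 1)) := by
  rintro ⟨f, c⟩
  constructor
  · intro h
    change evalForm x y (n + 1 + 1) f + c * (x * z - y * t) = 0 at h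
    have hc : c ∈ Ideal.span {x, y} ^ n := by
      refine mem_pow_of_mul_mem_pow hx hxy (t := t) hz n c ?_
      rw [← range_evalForm]
      exact ⟨-f, by rw [map_neg]; linear_combination -h⟩
    rw [← range_evalForm] at hc
    obtain ⟨q, rfl⟩ := hc
    obtain ⟨p, hp⟩ := exists_mulLinear_of_evalForm_eq_zero hx hxy (n + 1)
      (f + mulLinear z (-t) (n + 1) q) (by
        rw [map_add, evalForm_mulLinear]
        linear_combination h)
    exact ⟨(p, -q), by simp [syzygyOne, hp]⟩
  · rintro ⟨⟨p, q⟩, h⟩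
    rw [← h]
    change evalForm x y (n + 1 + 1) (mulLinear y (-x) (n + 1) p + mulLinear z (-t) (n + 1) q) +
      (0 + -evalForm x y (n + 1) q) * (x * z - y * t) = 0
    simp only [map_add, evalForm_mulLinear]
    ring

lemma exact_syzygyTwo_syzygyOne [IsDomain R] {x y z t : R} (hx : x ≠ 0) (hy : y ≠ 0)
    (hxy : ∀ a, x ∣ y * a → x ∣ a) (n : ℕ) :
    Function.Exact (syzygyTwo x y z t n) (syzygyOne x y z t (n + 1)) := by
  rintro ⟨p, q⟩
  have key : syzygyOne x y z t (n + 1) (p, q) =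
      (mulLinear y (-x) (n + 1) p + mulLinear z (-t) (n + 1) q, - evalForm x y (n + 1) q) := by
    simp [syzygyOne]
  rw [key, Prod.mk_eq_zero, neg_eq_zero]
  constructor
  · rintro ⟨h₁, h₂⟩
    obtain ⟨k, rfl⟩ := exists_mulLinear_of_evalForm_eq_zero
      (IsRegular.of_ne_zero hx).left hxy n q h₂
    refine ⟨-k, Prod.ext ?_ (by simp [syzygyTwo])⟩
    apply mulLinear_injective hy (-x) (n + 1)
    change mulLinear y (-x) (n + 1) (mulLinear z (-t) n (-k)) = _
    rw [mulLinear_comm, map_neg, map_neg]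
    exact (eq_neg_of_add_eq_zero_left h₁).symm
  · rintro ⟨k, h⟩
    obtain ⟨rfl, rfl⟩ := Prod.ext_iff.1 h
    change mulLinear y (-x) (n + 1) (mulLinear z (-t) n k) +
      mulLinear z (-t) (n + 1) (-mulLinear y (-x) n k) = 0 ∧
      evalForm x y (n + 1) (-mulLinear y (-x) n k) = 0
    rw [map_neg, mulLinear_comm, map_neg, evalForm_mulLinear]
    constructor <;> ring

lemma syzygyTwo_injective [IsDomain R] (x y : R) {z : R} (hz : z ≠ 0) (t : R) (n : ℕ) :
    Function.Injective (syzygyTwo x y z t n) := fun _ _ h =>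
  mulLinear_injective hz (-t) n (Prod.ext_iff.1 h).1

end BinaryForms

section DualSyzygy

variable {R : Type*} [CommRing R]

/-- The block matrix `[N_dᵀ, -M_dᵀ]`, where `d = n + 1`. -/
def dualSyzygyMatrix (x y z t : R) (n : ℕ) : Matrix (Fin n) (Fin (2 * (n + 1))) R :=
  Matrix.of fun i j =>
    if (j : ℕ) = (i : ℕ) then z
    else if (j : ℕ) = (i : ℕ) + 1 then -t
    else if (j : ℕ) = n + 1 + (i : ℕ) then -y
    else if (j : ℕ) = n + 1 + (i : ℕ) + 1 then x else 0

/-- The concatenation of the two standard bases. -/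
noncomputable def prodPiBasis (R : Type*) [CommRing R] (n : ℕ) :
    Module.Basis (Fin (2 * n)) R ((Fin n → R) × (Fin n → R)) :=
  ((Pi.basisFun R (Fin n)).prod (Pi.basisFun R (Fin n))).reindex
    (finSumFinEquiv.trans (finCongr (two_mul n).symm))

lemma syzygyTwo_single (x y z t : R) (n : ℕ) (i : Fin n) :
    syzygyTwo x y z t n (Pi.single i 1) =
      ∑ j, dualSyzygyMatrix x y z t n i j • prodPiBasis R (n + 1) j := by
  let E := finSumFinEquiv.trans (finCongr (two_mul (n + 1)).symm)
  have hbl (c : Fin (n + 1)) : prodPiBasis R (n + 1) (E (Sum.inl c)) = (Pi.single c 1, 0) := by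
    simp only [prodPiBasis, E, Module.Basis.reindex_apply, Equiv.symm_apply_apply]
    simp
  have hbr (c : Fin (n + 1)) : prodPiBasis R (n + 1) (E (Sum.inr c)) = (0, Pi.single c 1) := by
    simp only [prodPiBasis, E, Module.Basis.reindex_apply, Equiv.symm_apply_apply]
    simp
  have hml (c : Fin (n + 1)) : dualSyzygyMatrix x y z t n i (E (Sum.inl c)) =
      (if c = i.castSucc then z else 0) + if c = i.succ then -t else 0 := by
    have hv : (E (Sum.inl c) : ℕ) = c := rfl
    simp only [dualSyzygyMatrix, Matrix.of_apply, hv, Fin.ext_iff, Fin.val_castSucc, Fin.val_succ]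
    grind
  have hmr (c : Fin (n + 1)) : dualSyzygyMatrix x y z t n i (E (Sum.inr c)) =
      (if c = i.castSucc then -y else 0) + if c = i.succ then x else 0 := by
    have hv : (E (Sum.inr c) : ℕ) = n + 1 + c := by simp [E, add_comm]
    simp only [dualSyzygyMatrix, Matrix.of_apply, hv, Fin.ext_iff, Fin.val_castSucc, Fin.val_succ]
    grind
  rw [← E.sum_comp, Fintype.sum_sum_type]
  simp only [hbl, hbr, hml, hmr]
  ext k
  · simp [syzygyTwo, mulLinear_apply, snocZero_single, consZero_single, Pi.single_apply,
      Prod.fst_sum]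
    split_ifs <;> simp
  · simp [syzygyTwo, mulLinear_apply, snocZero_single, consZero_single, Pi.single_apply,
      Prod.snd_sum]
    split_ifs <;> ring

/-- The dual of `syzygyTwo` is given by `dualSyzygyMatrix`. -/
lemma map_range_lcomp_syzygyTwo (x y z t : R) (n : ℕ) :
    (LinearMap.range ((syzygyTwo x y z t n).lcomp R R)).map
      (((Pi.basisFun R (Fin n)).constr R (M' := R)).symm : _ →ₗ[R] _) =
      LinearMap.range (dualSyzygyMatrix x y z t n).mulVecLin := by
  have h : (((Pi.basisFun R (Fin n)).constr R (M' := R)).symm : _ →ₗ[R] _) ∘ₗ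
      (syzygyTwo x y z t n).lcomp R R =
      (dualSyzygyMatrix x y z t n).mulVecLin ∘ₗ
        (((prodPiBasis R (n + 1)).constr R (M' := R)).symm : _ →ₗ[R] _) := by
    ext φ i
    simp [syzygyTwo_single, Matrix.mulVec, dotProduct, Module.Basis.constr]
  rw [← LinearMap.range_comp, h, LinearMap.range_comp_of_range_eq_top _ (LinearEquiv.range _)]

end DualSyzygy

section SpanPair

variable {σ K : Type*} [Field K]

lemma MvPolynomial.isPrime_span_X_pair (i j : σ) :
    (Ideal.span {(X i : MvPolynomial σ K), X j}).IsPrime := by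
  classical
  let φ : MvPolynomial σ K →ₐ[K] MvPolynomial σ K :=
    aeval fun k => if k = i ∨ k = j then 0 else X k
  suffices Ideal.span {(X i : MvPolynomial σ K), X j} = RingHom.ker φ from
    this ▸ RingHom.ker_isPrime φ
  apply le_antisymm
  · rw [Ideal.span_le]
    rintro _ (rfl | rfl) <;> simp [φ, RingHom.mem_ker]
  · intro p hp
    have key : (Ideal.Quotient.mkₐ K (Ideal.span {(X i : MvPolynomial σ K), X j})).comp φ =
        Ideal.Quotient.mkₐ K _ := by
      ext k
      by_cases hk : k = i ∨ k = j
      · have : (X k : MvPolynomial σ K) ∈ Ideal.span {(X i : MvPolynomial σ K), X j} :=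
          Ideal.subset_span (by obtain rfl | rfl := hk <;> simp)
        simpa [φ, hk] using (Ideal.Quotient.eq_zero_iff_mem.2 this).symm
      · simp [φ, hk]
    rw [← Ideal.Quotient.eq_zero_iff_mem]
    have := DFunLike.congr_fun key p
    simpa [(RingHom.mem_ker).1 hp] using this.symm

lemma MvPolynomial.X_notMem_span_X_pair {i j k : σ} (hi : k ≠ i) (hj : k ≠ j) :
    (X k : MvPolynomial σ K) ∉ Ideal.span {(X i : MvPolynomial σ K), X j} := by
  rw [← Set.image_pair X, mem_ideal_span_X_image]
  intro h
  obtain ⟨l, hl, h⟩ := h (Finsupp.single k 1) (by simp [support_X])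
  obtain rfl | rfl := hl <;> simp_all

lemma MvPolynomial.X_dvd_of_X_dvd_X_mul {i j : σ} (hij : i ≠ j) {a : MvPolynomial σ K}
    (h : X i ∣ X j * a) : X i ∣ a := by
  refine ((X_prime (i := i)).dvd_or_dvd h).resolve_left fun h => ?_
  simp_all [X_dvd_X]

end SpanPair

/-- Corollary 3.2 of "The equations of space curves on a quadric" by Di Gennaro and
Nagel (ungraded version): for `d ≥ 2` and `I_d = (xz - yt) + (x,y)^d`, the module
`Ext²_R(I_d, R)` is isomorphic to the cokernel of the map `R^{2d} → R^{d-1}` given by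
the block matrix `[N_dᵀ, -M_dᵀ]`. -/
theorem ext_two_multiple_line_smooth_quadric
    (K : Type) [Field K] (d : ℕ) (hd : 2 ≤ d)
    (I : Ideal (MvPolynomial (Fin 4) K))
    (hI : I = Ideal.span {X 0 * X 2 - X 1 * X 3} +
      (Ideal.span {X 0, X 1} : Ideal (MvPolynomial (Fin 4) K)) ^ d)
    (Φ : (Fin (2 * d) → MvPolynomial (Fin 4) K) →ₗ[MvPolynomial (Fin 4) K]
      (Fin (d - 1) → MvPolynomial (Fin 4) K))
    (hΦ : Φ = Matrix.mulVecLin (Matrix.of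
      (fun (i : Fin (d - 1)) (j : Fin (2 * d)) =>
        -- block N_dᵀ followed by block -M_dᵀ
        if (j : ℕ) = (i : ℕ) then X 2
        else if (j : ℕ) = (i : ℕ) + 1 then -(X 3)
        else if (j : ℕ) = d + (i : ℕ) then -(X 1)
        else if (j : ℕ) = d + (i : ℕ) + 1 then X 0 else 0))) :
    Nonempty
      ((((Ext (MvPolynomial (Fin 4) K) (ModuleCat (MvPolynomial (Fin 4) K)) 2).obj
          (Opposite.op (ModuleCat.of (MvPolynomial (Fin 4) K) I))).obj
          (ModuleCat.of (MvPolynomial (Fin 4) K) (MvPolynomial (Fin 4) K))) ≅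
        ModuleCat.of (MvPolynomial (Fin 4) K)
          ((Fin (d - 1) → MvPolynomial (Fin 4) K) ⧸ LinearMap.range Φ)) := by
  obtain ⟨n, rfl⟩ : ∃ n, d = n + 1 := ⟨d - 1, by lia⟩
  have := isPrime_span_X_pair (K := K) (0 : Fin 4) 1
  have hX (i : Fin 4) : (X i : MvPolynomial (Fin 4) K) ≠ 0 := X_ne_zero i
  have hX₂ := X_notMem_span_X_pair (K := K) (i := (0 : Fin 4)) (j := 1) (k := 2)
    (by decide) (by decide)
  have hdvd (a : MvPolynomial (Fin 4) K) (h : X 0 ∣ X 1 * a) : X 0 ∣ a :=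
    X_dvd_of_X_dvd_X_mul (by decide) h
  let G := generatorsMap (X 0 : MvPolynomial (Fin 4) K) (X 1) (X 2) (X 3) (n + 1)
  have hG : LinearMap.range G = I := (range_generatorsMap _ _ _ _ _).trans hI.symm
  let G' := G.codRestrict I fun p => hG ▸ ⟨p, rfl⟩
  obtain ⟨e⟩ := nonempty_ext_two_iso _ _ G' (syzygyTwo_injective (X 0) (X 1) (hX 2) (X 3) n)
    (exact_syzygyTwo_syzygyOne (hX 0) (hX 1) hdvd n)
    (fun p => by
      rw [← exact_syzygyOne_generatorsMap (IsRegular.of_ne_zero (hX 0)).left hdvd hX₂ n p]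
      exact Subtype.ext_iff)
    (by
      rintro ⟨c, hc⟩
      obtain ⟨p, rfl⟩ := hG.symm ▸ hc
      exact ⟨p, rfl⟩) (MvPolynomial (Fin 4) K)
  exact ⟨e ≪≫ (Submodule.Quotient.equiv _ _ _
    ((map_range_lcomp_syzygyTwo _ _ _ _ n).trans (by rw [hΦ]; rfl))).toModuleIso⟩
end

section
/- Let K be a field and R = K[x,y,z,t]. Let a₁, …, a_m ∈ K be pairwise distinct scalars, let d₁, …, d_m ≥ 1 be integers, and for each i let P_i ⊆ R be the ideal P_i = (y − a_i·x, z − a_i·t). Then the following equality of ideals of R holds: ⋂_{i=1}^m ((xz − yt) + P_i^{d_i}) = (xz − yt) + P₁^{d₁}·P₂^{d₂}·…·P_m^{d_m}. -/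
open MvPolynomial

section SegreSection

variable {B : Type*} [CommRing B]

/-- If `x * z = y * t`, the element of `B` corresponding to the monomial `p ^ a * q ^ b * u ^ c * v ^ e`
under `x = p * u`, `y = q * u`, `z = q * v`, `t = p * v`, and `0` if there is no such element. -/
def segreMonomial (x y z t : B) (a b c e : ℕ) : B :=
  if a + b = c + e then x ^ min a c * y ^ (c - a) * t ^ (a - c) * z ^ min b e else 0

variable {x y z t : B}

lemma segreMonomial_of_ne {a b c e : ℕ} (h : a + b ≠ c + e) :
    segreMonomial x y z t a b c e = 0 := if_neg h

lemma segreMonomial_add_left (a k e : ℕ) :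
    segreMonomial x y z t a (e + k) (a + k) e = x ^ a * y ^ k * z ^ e := by
  rw [segreMonomial, if_pos (by omega), min_eq_left (by omega), min_eq_right (by omega),
    Nat.add_sub_cancel_left, Nat.sub_eq_zero_of_le (by omega), pow_zero, mul_one]

lemma segreMonomial_add_right (c k b : ℕ) :
    segreMonomial x y z t (c + k) b c (b + k) = x ^ c * t ^ k * z ^ b := by
  rw [segreMonomial, if_pos (by omega), min_eq_right (by omega), min_eq_left (by omega),
    Nat.add_sub_cancel_left, Nat.sub_eq_zero_of_le (by omega), pow_zero, mul_one]

lemma segreMonomial_cases {motive : ℕ → ℕ → ℕ → ℕ → Prop}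
    (ne : ∀ a b c e, a + b ≠ c + e → motive a b c e)
    (left : ∀ a k e, motive a (e + k) (a + k) e)
    (right : ∀ c k b, motive (c + (k + 1)) b c (b + (k + 1))) (a b c e : ℕ) :
    motive a b c e := by
  by_cases h : a + b = c + e
  · rcases Nat.lt_or_ge c a with h' | h'
    · obtain ⟨k, rfl⟩ := Nat.exists_eq_add_of_lt h'
      obtain rfl : e = b + (k + 1) := by omega
      exact right c k b
    · obtain ⟨k, rfl⟩ := Nat.exists_eq_add_of_le h'
      obtain rfl : b = e + k := by omega
      exact left a k e
  · exact ne a b c e h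

lemma segreMonomial_mul_x (a b c e : ℕ) :
    segreMonomial x y z t (a + 1) b (c + 1) e = x * segreMonomial x y z t a b c e := by
  induction a, b, c, e using segreMonomial_cases with
  | ne a b c e h => rw [segreMonomial_of_ne h, segreMonomial_of_ne (by omega), mul_zero]
  | left a k e =>
    rw [segreMonomial_add_left, Nat.add_right_comm a k 1, segreMonomial_add_left]
    ring
  | right c k b =>
    rw [segreMonomial_add_right, Nat.add_right_comm c (k + 1) 1, segreMonomial_add_right]
    ring

lemma segreMonomial_mul_z (a b c e : ℕ) :
    segreMonomial x y z t a (b + 1) c (e + 1) = z * segreMonomial x y z t a b c e := by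
  induction a, b, c, e using segreMonomial_cases with
  | ne a b c e h => rw [segreMonomial_of_ne h, segreMonomial_of_ne (by omega), mul_zero]
  | left a k e =>
    rw [segreMonomial_add_left, Nat.add_right_comm e k 1, segreMonomial_add_left]
    ring
  | right c k b =>
    rw [segreMonomial_add_right, Nat.add_right_comm b (k + 1) 1, segreMonomial_add_right]
    ring

lemma segreMonomial_mul_y (hxyzt : x * z = y * t) (a b c e : ℕ) :
    segreMonomial x y z t a (b + 1) (c + 1) e = y * segreMonomial x y z t a b c e := by
  induction a, b, c, e using segreMonomial_cases with
  | ne a b c e h => rw [segreMonomial_of_ne h, segreMonomial_of_ne (by omega), mul_zero]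
  | left a k e =>
    rw [segreMonomial_add_left, Nat.add_assoc, Nat.add_assoc, segreMonomial_add_left]
    ring
  | right c k b =>
    rw [segreMonomial_add_right, Nat.add_comm k 1, ← Nat.add_assoc, ← Nat.add_assoc,
      segreMonomial_add_right]
    linear_combination x ^ c * t ^ k * z ^ b * hxyzt

lemma segreMonomial_mul_t (hxyzt : x * z = y * t) (a b c e : ℕ) :
    segreMonomial x y z t (a + 1) b c (e + 1) = t * segreMonomial x y z t a b c e := by
  induction a, b, c, e using segreMonomial_cases with
  | ne a b c e h => rw [segreMonomial_of_ne h, segreMonomial_of_ne (by omega), mul_zero]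
  | left a k e =>
    rw [segreMonomial_add_left]
    cases k with
    | zero =>
      have h := segreMonomial_add_right (x := x) (y := y) (z := z) (t := t) a 1 e
      simp only [Nat.add_zero, h]
      ring
    | succ k =>
      rw [Nat.add_comm k 1, ← Nat.add_assoc, ← Nat.add_assoc, segreMonomial_add_left]
      linear_combination x ^ a * y ^ k * z ^ e * hxyzt
  | right c k b =>
    rw [segreMonomial_add_right, Nat.add_assoc, Nat.add_assoc b, segreMonomial_add_right]
    ring

end SegreSection

section SegreMap

variable (K : Type*) [Field K]

/-- The ideal of the smooth quadric `xz = yt`. -/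
noncomputable abbrev quadricIdeal : Ideal (MvPolynomial (Fin 4) K) :=
  Ideal.span {X 0 * X 2 - X 1 * X 3}

/-- The ideal of the line `y = ax`, `z = at`. -/
noncomputable abbrev lineIdeal {K : Type*} [Field K] (a : K) : Ideal (MvPolynomial (Fin 4) K) :=
  Ideal.span {X 1 - C a * X 0, X 2 - C a * X 3}

/-- The Segre map `x ↦ pu`, `y ↦ qu`, `z ↦ qv`, `t ↦ pv`, where `p, q, u, v` are the variables
of the target. -/
noncomputable def segreMap : MvPolynomial (Fin 4) K →ₐ[K] MvPolynomial (Fin 4) K :=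
  aeval ![X 0 * X 2, X 1 * X 2, X 1 * X 3, X 0 * X 3]

/-- A retraction of the Segre map, linear over the coordinate ring of the quadric. -/
noncomputable def segreRetraction :
    MvPolynomial (Fin 4) K →ₗ[K] MvPolynomial (Fin 4) K ⧸ quadricIdeal K :=
  (basisMonomials (Fin 4) K).constr K fun m =>
    segreMonomial (Ideal.Quotient.mk (quadricIdeal K) (X 0)) (Ideal.Quotient.mk _ (X 1))
      (Ideal.Quotient.mk _ (X 2)) (Ideal.Quotient.mk _ (X 3)) (m 0) (m 1) (m 2) (m 3)

variable {K}

lemma segreRetraction_monomial_one (m : Fin 4 →₀ ℕ) :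
    segreRetraction K (monomial m 1) =
      segreMonomial (Ideal.Quotient.mk (quadricIdeal K) (X 0)) (Ideal.Quotient.mk _ (X 1))
        (Ideal.Quotient.mk _ (X 2)) (Ideal.Quotient.mk _ (X 3)) (m 0) (m 1) (m 2) (m 3) := by
  have h : monomial m (1 : K) = basisMonomials (Fin 4) K m := by rw [coe_basisMonomials]
  rw [h, segreRetraction, Module.Basis.constr_basis]

lemma quadric_relation :
    Ideal.Quotient.mk (quadricIdeal K) (X 0) * Ideal.Quotient.mk (quadricIdeal K) (X 2) =
      Ideal.Quotient.mk (quadricIdeal K) (X 1) * Ideal.Quotient.mk (quadricIdeal K) (X 3) := by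
  rw [← map_mul, ← map_mul, Ideal.Quotient.eq]
  exact Ideal.mem_span_singleton_self _

lemma segreRetraction_X_mul_monomial (i : Fin 4) (m : Fin 4 →₀ ℕ) :
    segreRetraction K (segreMap K (X i) * monomial m 1) =
      Ideal.Quotient.mk (quadricIdeal K) (X i) * segreRetraction K (monomial m 1) := by
  rw [segreMap, aeval_X]
  fin_cases i <;>
    simp only [Fin.zero_eta, Fin.mk_one, Fin.reduceFinMk, Matrix.cons_val] <;>
    rw [X, X, monomial_mul, monomial_mul, mul_one, mul_one, segreRetraction_monomial_one,
      segreRetraction_monomial_one] <;>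
    simp only [Finsupp.add_apply, Finsupp.single_apply, Fin.reduceEq, if_true, if_false,
      zero_add, add_zero, one_ne_zero, zero_ne_one, Nat.add_comm 1]
  · exact segreMonomial_mul_x ..
  · exact segreMonomial_mul_y quadric_relation ..
  · exact segreMonomial_mul_z ..
  · exact segreMonomial_mul_t quadric_relation ..

lemma segreRetraction_segreMap_mul (f g : MvPolynomial (Fin 4) K) :
    segreRetraction K (segreMap K f * g) =
      Ideal.Quotient.mk (quadricIdeal K) f * segreRetraction K g := by
  induction f using MvPolynomial.induction_on generalizing g with
  | C r =>
    rw [← algebraMap_eq, AlgHom.commutes, ← Algebra.smul_def, map_smul]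
    exact Algebra.smul_def (A := MvPolynomial (Fin 4) K ⧸ quadricIdeal K) r _
  | add f₁ f₂ h₁ h₂ => simp only [map_add, add_mul, h₁, h₂]
  | mul_X f i h =>
    have hX : segreRetraction K (segreMap K (X i) * g) =
        Ideal.Quotient.mk (quadricIdeal K) (X i) * segreRetraction K g := by
      induction g using MvPolynomial.induction_on' with
      | add g₁ g₂ h₁ h₂ => simp only [map_add, mul_add, h₁, h₂]
      | monomial m r =>
        have hm : monomial m r = r • monomial m (1 : K) := by
          rw [smul_monomial, smul_eq_mul, mul_one]
        rw [hm, mul_smul_comm, map_smul, map_smul, segreRetraction_X_mul_monomial, mul_smul_comm]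
    rw [map_mul (segreMap K), mul_assoc, h, hX, map_mul, mul_assoc]

lemma segreRetraction_segreMap (f : MvPolynomial (Fin 4) K) :
    segreRetraction K (segreMap K f) = Ideal.Quotient.mk (quadricIdeal K) f := by
  have h := segreRetraction_segreMap_mul f 1
  have h1 : segreRetraction K 1 = 1 := by
    rw [← C_1, C_apply, segreRetraction_monomial_one]
    simp [segreMonomial]
  rwa [mul_one, h1, mul_one] at h

/-- The weights of the difference of the two partial degrees in `p, q` and in `u, v`. -/
def bidegreeWeight : Fin 4 → ℤ := ![1, 1, -1, -1]

lemma weight_bidegreeWeight (m : Fin 4 →₀ ℕ) :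
    Finsupp.weight bidegreeWeight m = (m 0 + m 1 - m 2 - m 3 : ℤ) := by
  rw [Finsupp.weight_apply, Finsupp.sum_fintype _ _ (by simp)]
  simp [Fin.sum_univ_four, bidegreeWeight]
  ring

lemma segreRetraction_eq_zero {f : MvPolynomial (Fin 4) K} {n : ℤ}
    (hf : IsWeightedHomogeneous bidegreeWeight f n) (hn : n ≠ 0) :
    segreRetraction K f = 0 := by
  rw [f.as_sum, map_sum]
  refine Finset.sum_eq_zero fun m hm => ?_
  have hw := hf (mem_support_iff.mp hm)
  rw [weight_bidegreeWeight] at hw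
  rw [← mul_one (coeff m f), ← smul_eq_mul, ← smul_monomial, map_smul,
    segreRetraction_monomial_one, segreMonomial_of_ne (by omega), smul_zero]

/-- The equation of a line of the ruling in the coordinates `p, q`. -/
noncomputable def lineForm (a : K) : MvPolynomial (Fin 4) K := X 1 - C a * X 0

lemma isWeightedHomogeneous_lineForm (a : K) :
    IsWeightedHomogeneous bidegreeWeight (lineForm a) 1 := by
  refine IsWeightedHomogeneous.sub (isWeightedHomogeneous_X K bidegreeWeight 1) ?_
  have h := (isWeightedHomogeneous_C bidegreeWeight a).mul
    (isWeightedHomogeneous_X K bidegreeWeight 0)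
  rwa [zero_add] at h

lemma isRelPrime_lineForm {a b : K} (hab : a ≠ b) : IsRelPrime (lineForm a) (lineForm b) := by
  intro g ha hb
  have h0 : g ∣ X 0 := by
    have h := (dvd_sub ha hb).mul_left (C (b - a)⁻¹)
    have e : C (b - a)⁻¹ * (lineForm a - lineForm b) = (X 0 : MvPolynomial (Fin 4) K) := by
      have hc : (C (b - a)⁻¹ * (C b - C a) : MvPolynomial (Fin 4) K) = 1 := by
        rw [← C_sub, ← C_mul, inv_mul_cancel₀ (sub_ne_zero.mpr hab.symm), C_1]
      rw [lineForm, lineForm]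
      linear_combination X 0 * hc
    rwa [e] at h
  have h1 : g ∣ X 1 := by
    have h := dvd_add ha (h0.mul_left (C a))
    rwa [lineForm, sub_add_cancel] at h
  refine (Irreducible.isRelPrime_iff_not_dvd (X_prime (R := K) (i := (0 : Fin 4))).irreducible).mpr
    ?_ h0 h1
  simp [X_dvd_X]

lemma segreMap_lineIdeal_pow_dvd {a : K} {n : ℕ} {f : MvPolynomial (Fin 4) K}
    (hf : f ∈ quadricIdeal K + lineIdeal a ^ n) : lineForm a ^ n ∣ segreMap K f := by
  rw [← Ideal.mem_span_singleton, ← Ideal.mem_comap]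
  refine (sup_le ?_ ?_ : quadricIdeal K ⊔ lineIdeal a ^ n ≤ _) hf
  · rw [Ideal.span_singleton_le_iff_mem, Ideal.mem_comap]
    have : segreMap K (X 0 * X 2 - X 1 * X 3) = 0 := by
      simp [segreMap]
      ring
    rw [this]
    exact Ideal.zero_mem _
  · rw [← Ideal.span_singleton_pow]
    refine le_trans (Ideal.pow_right_mono ?_ n) (Ideal.le_comap_pow _ n)
    rw [Ideal.span_le]
    rintro _ (rfl | rfl)
    · refine Ideal.mem_span_singleton.mpr ⟨X 2, ?_⟩
      simp [segreMap, lineForm, ← algebraMap_eq]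
      ring
    · refine Ideal.mem_span_singleton.mpr ⟨X 3, ?_⟩
      simp [segreMap, lineForm, ← algebraMap_eq]
      ring

lemma exists_mem_lineIdeal_pow (a : K) (c e : ℕ) :
    ∃ h ∈ lineIdeal a ^ (c + e),
      segreMap K h = lineForm a ^ (c + e) * (X 2 ^ c * X 3 ^ e) := by
  refine ⟨(X 1 - C a * X 0) ^ c * (X 2 - C a * X 3) ^ e, ?_, ?_⟩
  · rw [pow_add]
    exact Ideal.mul_mem_mul (Ideal.pow_mem_pow (Ideal.subset_span (by simp)) c)
      (Ideal.pow_mem_pow (Ideal.subset_span (by simp)) e)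
  · have h1 : segreMap K (X 1 - C a * X 0) = lineForm a * X 2 := by
      simp [segreMap, lineForm, ← algebraMap_eq]
      ring
    have h2 : segreMap K (X 2 - C a * X 3) = lineForm a * X 3 := by
      simp [segreMap, lineForm, ← algebraMap_eq]
      ring
    rw [map_mul, map_pow, map_pow, h1, h2]
    ring

lemma exists_mem_prod_lineIdeal_pow {ι : Type*} (a : ι → K) (d : ι → ℕ) (s : Finset ι)
    (c e : ℕ) (hce : c + e = ∑ i ∈ s, d i) :
    ∃ h ∈ ∏ i ∈ s, lineIdeal (a i) ^ d i,
      segreMap K h = (∏ i ∈ s, lineForm (a i) ^ d i) * (X 2 ^ c * X 3 ^ e) := by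
  classical
  induction s using Finset.induction_on generalizing c e with
  | empty =>
    obtain ⟨rfl, rfl⟩ : c = 0 ∧ e = 0 := by simpa using hce
    exact ⟨1, by simp, by simp⟩
  | insert i s hi ih =>
    rw [Finset.sum_insert hi] at hce
    obtain ⟨c₁, e₁, c₂, e₂, rfl, rfl, h₁⟩ :
        ∃ c₁ e₁ c₂ e₂, c = c₁ + c₂ ∧ e = e₁ + e₂ ∧ c₁ + e₁ = d i :=
      ⟨min c (d i), d i - min c (d i), c - min c (d i), e - (d i - min c (d i)),
        by omega, by omega, by omega⟩
    obtain ⟨f, hf, hf'⟩ := exists_mem_lineIdeal_pow (a i) c₁ e₁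
    obtain ⟨g, hg, hg'⟩ := ih c₂ e₂ (by omega)
    rw [h₁] at hf hf'
    refine ⟨f * g, ?_, ?_⟩
    · rw [Finset.prod_insert hi]
      exact Ideal.mul_mem_mul hf hg
    · rw [map_mul, hf', hg', Finset.prod_insert hi]
      ring

lemma segreRetraction_prod_lineForm_mul_mem {ι : Type*} (a : ι → K) (d : ι → ℕ) (s : Finset ι)
    (g : MvPolynomial (Fin 4) K) :
    segreRetraction K ((∏ i ∈ s, lineForm (a i) ^ d i) * g) ∈
      (∏ i ∈ s, lineIdeal (a i) ^ d i).map (Ideal.Quotient.mk (quadricIdeal K)) := by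
  induction g using MvPolynomial.induction_on' with
  | add g₁ g₂ h₁ h₂ =>
    rw [mul_add, map_add]
    exact Ideal.add_mem _ h₁ h₂
  | monomial m r =>
    by_cases hm : m 0 + m 1 + ∑ i ∈ s, d i = m 2 + m 3
    · obtain ⟨c, e, c', e', hc, he, hce⟩ :
          ∃ c e c' e', m 2 = c + c' ∧ m 3 = e + e' ∧ c + e = ∑ i ∈ s, d i :=
        ⟨min (m 2) (∑ i ∈ s, d i), ∑ i ∈ s, d i - min (m 2) (∑ i ∈ s, d i),
          m 2 - min (m 2) (∑ i ∈ s, d i),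
          m 3 - (∑ i ∈ s, d i - min (m 2) (∑ i ∈ s, d i)), by omega, by omega, by omega⟩
      obtain ⟨h, hh, hh'⟩ := exists_mem_prod_lineIdeal_pow a d s c e hce
      have key : (∏ i ∈ s, lineForm (a i) ^ d i) * monomial m r =
          segreMap K h * (C r * (X 0 ^ m 0 * X 1 ^ m 1 * X 2 ^ c' * X 3 ^ e')) := by
        rw [hh', monomial_eq, Finsupp.prod_fintype _ _ (by simp), Fin.prod_univ_four, hc, he]
        ring
      rw [key, segreRetraction_segreMap_mul]
      exact Ideal.mul_mem_right _ _ (Ideal.mem_map_of_mem _ hh)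
    · have hw := (IsWeightedHomogeneous.prod s (fun i => lineForm (a i) ^ d i) _
        fun i _ => (isWeightedHomogeneous_lineForm (a i)).pow (d i)).mul
        (isWeightedHomogeneous_monomial bidegreeWeight m r rfl)
      rw [segreRetraction_eq_zero hw]
      · exact Ideal.zero_mem _
      · rw [weight_bidegreeWeight]
        simp only [nsmul_eq_mul, mul_one, ← Nat.cast_sum]
        omega

lemma mem_of_prod_lineForm_dvd {ι : Type*} (a : ι → K) (d : ι → ℕ) (s : Finset ι)
    {f : MvPolynomial (Fin 4) K} (hf : ∏ i ∈ s, lineForm (a i) ^ d i ∣ segreMap K f) :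
    f ∈ quadricIdeal K + ∏ i ∈ s, lineIdeal (a i) ^ d i := by
  obtain ⟨g, hg⟩ := hf
  have h := segreRetraction_prod_lineForm_mul_mem a d s g
  rw [← hg, segreRetraction_segreMap, ← Ideal.mem_comap,
    Ideal.comap_map_of_surjective _ Ideal.Quotient.mk_surjective, ← RingHom.ker_eq_comap_bot,
    Ideal.mk_ker, sup_comm] at h
  exact h

end SegreMap

/-- Theorem 1.3 / Lemma 3.4 / Corollary 3.5 of "The equations of space curves on a
quadric" by Di Gennaro and Nagel: for distinct lines `L_i = {y - a_i x = z - a_i t = 0}`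
in one ruling of the smooth quadric `{xz - yt = 0}`, the intersection of the ideals
`(xz - yt) + I_{L_i}^{d_i}` equals `(xz - yt) + I_{L_1}^{d_1} ⋯ I_{L_m}^{d_m}`. -/
theorem ideal_curve_smooth_quadric
    {K : Type*} [Field K] {m : ℕ} (a : Fin m → K) (ha : Function.Injective a)
    (d : Fin m → ℕ) (hd : ∀ i, 1 ≤ d i) :
    (⨅ i : Fin m,
        (Ideal.span {X 0 * X 2 - X 1 * X 3} +
          (Ideal.span {X 1 - C (a i) * X 0, X 2 - C (a i) * X 3} :
            Ideal (MvPolynomial (Fin 4) K)) ^ (d i))) =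
      Ideal.span {X 0 * X 2 - X 1 * X 3} +
        ∏ i : Fin m,
          (Ideal.span {X 1 - C (a i) * X 0, X 2 - C (a i) * X 3} :
            Ideal (MvPolynomial (Fin 4) K)) ^ (d i) := by
  refine le_antisymm (fun f hf => ?_) (le_iInf fun i => ?_)
  · rw [Ideal.mem_iInf] at hf
    refine mem_of_prod_lineForm_dvd a d Finset.univ (Finset.prod_dvd_of_isRelPrime ?_ ?_)
    · exact fun i _ j _ hij => (isRelPrime_lineForm (ha.ne hij)).pow
    · exact fun i _ => segreMap_lineIdeal_pow_dvd (hf i)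
  · exact sup_le_sup_left
      (Ideal.prod_le_inf.trans (Finset.inf_le (Finset.mem_univ i))) _
end

section
/- Let K be a field, R = K[x,y,z,t], and let s ≥ 1 be an integer. Let Φ_s : R^{2s+2} → R^s be the R-linear map given by the s×(2s+2) matrix [Y | Z], where Y is the s×(s+1) matrix with Y_{i,i} = y, Y_{i,i+1} = −x and zeros elsewhere, and Z is the s×(s+1) matrix with Z_{i,i} = z, Z_{i,i+1} = −t and zeros elsewhere. Then the polynomial xz − yt annihilates the cokernel of Φ_s; that is, for every v ∈ R^s one has (xz − yt)·v ∈ im Φ_s. -/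
open MvPolynomial

/-- The quadric `xz - yt` annihilates the cokernel of the presentation matrix
`Φ_s = [Y | Z]` of the Hartshorne–Rao module of a minimal curve on the smooth quadric
(Theorem 4.1(ii) of "The equations of space curves on a quadric" by Di Gennaro and
Nagel). -/
theorem quadric_annihilates_coker
    {K : Type*} [Field K] (s : ℕ) (hs : 1 ≤ s)
    (Φ : (Fin (2 * s + 2) → MvPolynomial (Fin 4) K) →ₗ[MvPolynomial (Fin 4) K]
      (Fin s → MvPolynomial (Fin 4) K))
    (hΦ : Φ = Matrix.mulVecLin (Matrix.of
      (fun (i : Fin s) (j : Fin (2 * s + 2)) =>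
        if (j : ℕ) < s + 1 then
          -- block Y
          (if (j : ℕ) = (i : ℕ) then X 1
           else if (j : ℕ) = (i : ℕ) + 1 then -(X 0) else 0)
        else
          -- block Z
          (if (j : ℕ) = (s + 1) + (i : ℕ) then X 2
           else if (j : ℕ) = (s + 1) + (i : ℕ) + 1 then -(X 3) else 0)))) :
    ∀ v : Fin s → MvPolynomial (Fin 4) K,
      ((X 0 * X 2 - X 1 * X 3 : MvPolynomial (Fin 4) K)) • v ∈ LinearMap.range Φ := by
  intro v
  subst hΦ
  rw [pi_eq_sum_univ' v, Finset.smul_sum]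
  refine Submodule.sum_mem _ fun k _ => ?_
  rw [smul_comm]
  refine Submodule.smul_mem _ _
    ⟨X 0 • Pi.single ⟨s + 1 + k, by omega⟩ 1 - X 3 • Pi.single ⟨k, by omega⟩ 1, ?_⟩
  rw [map_sub, map_smul, map_smul]
  simp only [Matrix.mulVecLin_apply, Matrix.mulVec_single_one]
  ext1 i
  have hk : (k : ℕ) < s + 1 := by omega
  have hk' : ¬ s + (1 + (k : ℕ)) < s + 1 := by omega
  simp only [Pi.sub_apply, Pi.smul_apply, Matrix.col_apply, Matrix.of_apply, smul_eq_mul,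
    hk, hk', if_true, if_false, add_assoc, add_right_inj, Pi.single_apply, Fin.ext_iff]
  split_ifs <;> first | omega | ring
end

section
/- Let K be a field, R = K[x,y,z,t], and let s ≥ 2 be an integer. Let Φ_s : R^{2s+2} → R^s be the R-linear map given by the s×(2s+2) matrix [Y | Z], where Y is the s×(s+1) matrix with Y_{i,i} = y, Y_{i,i+1} = −x and zeros elsewhere, and Z is the s×(s+1) matrix with Z_{i,i} = z, Z_{i,i+1} = −t and zeros elsewhere. Then no nonzero linear form annihilates the cokernel of Φ_s; that is, if ℓ = a·x + b·y + c·z + e·t with a, b, c, e ∈ K satisfies ℓ·v ∈ im Φ_s for all v ∈ R^s, then a = b = c = e = 0. -/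
open MvPolynomial

/-- The coefficient of the variable `X k` in a product `X m * p` is the constant coefficient
of `p` if `m = k`, and zero otherwise. -/
theorem coeff_single_one_X_mul {R σ : Type*} [CommSemiring R] [DecidableEq σ] (k m : σ)
    (p : MvPolynomial σ R) :
    coeff (Finsupp.single k 1) (X m * p) = if m = k then coeff 0 p else 0 := by
  rw [coeff_X_mul']
  by_cases h : m = k
  · subst h; simp
  · simp [h]

/-- A row of the product of the matrix `[Y | Z]` with a vector. -/
theorem sum_blocks_mul {R : Type*} [CommRing R] (x y z t : R) (s : ℕ) (i : Fin s)
    (w : Fin (2 * s + 2) → R) :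
    ∑ j : Fin (2 * s + 2),
      (if (j : ℕ) < s + 1 then
        (if (j : ℕ) = (i : ℕ) then y else if (j : ℕ) = (i : ℕ) + 1 then -x else 0)
      else
        (if (j : ℕ) = (s + 1) + (i : ℕ) then z
          else if (j : ℕ) = (s + 1) + (i : ℕ) + 1 then -t else 0)) * w j =
      y * w ⟨i, by omega⟩ - x * w ⟨i + 1, by omega⟩ + z * w ⟨s + 1 + i, by omega⟩ -
        t * w ⟨s + 1 + i + 1, by omega⟩ := by
  have hi := i.isLt
  have key (j : Fin (2 * s + 2)) :
      (if (j : ℕ) < s + 1 then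
        (if (j : ℕ) = (i : ℕ) then y else if (j : ℕ) = (i : ℕ) + 1 then -x else 0)
      else
        (if (j : ℕ) = (s + 1) + (i : ℕ) then z
          else if (j : ℕ) = (s + 1) + (i : ℕ) + 1 then -t else 0)) * w j =
      (if j = ⟨i, by omega⟩ then y * w j else 0) - (if j = ⟨i + 1, by omega⟩ then x * w j else 0) +
        (if j = ⟨s + 1 + i, by omega⟩ then z * w j else 0) -
        (if j = ⟨s + 1 + i + 1, by omega⟩ then t * w j else 0) := by
    simp only [Fin.ext_iff]
    split_ifs <;> first | omega | ring
  simp only [key, Finset.sum_sub_distrib, Finset.sum_add_distrib, Finset.sum_ite_eq',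
    Finset.mem_univ, if_true]

/-- For `s ≥ 2`, no nonzero linear form annihilates the cokernel of the presentation
matrix `Φ_s = [Y | Z]` of the Hartshorne–Rao module of a minimal curve on the smooth
quadric (used in the proof of Theorem 4.1 of "The equations of space curves on a
quadric" by Di Gennaro and Nagel). -/
theorem no_linear_form_annihilates_coker
    {K : Type*} [Field K] (s : ℕ) (hs : 2 ≤ s)
    (Φ : (Fin (2 * s + 2) → MvPolynomial (Fin 4) K) →ₗ[MvPolynomial (Fin 4) K]
      (Fin s → MvPolynomial (Fin 4) K))
    (hΦ : Φ = Matrix.mulVecLin (Matrix.of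
      (fun (i : Fin s) (j : Fin (2 * s + 2)) =>
        if (j : ℕ) < s + 1 then
          -- block Y
          (if (j : ℕ) = (i : ℕ) then X 1
           else if (j : ℕ) = (i : ℕ) + 1 then -(X 0) else 0)
        else
          -- block Z
          (if (j : ℕ) = (s + 1) + (i : ℕ) then X 2
           else if (j : ℕ) = (s + 1) + (i : ℕ) + 1 then -(X 3) else 0))))
    (a b c e : K)
    (hann : ∀ v : Fin s → MvPolynomial (Fin 4) K,
      ((C a * X 0 + C b * X 1 + C c * X 2 + C e * X 3 : MvPolynomial (Fin 4) K)) • v ∈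
        LinearMap.range Φ) :
    a = 0 ∧ b = 0 ∧ c = 0 ∧ e = 0 := by
  have rel (v : Fin s → K) : b * v ⟨1, hs⟩ = -(a * v ⟨0, by omega⟩) ∧
      c * v ⟨1, hs⟩ = -(e * v ⟨0, by omega⟩) := by
    obtain ⟨w, hw⟩ := hann fun i => C (v i)
    have row (i : Fin s) := congrFun hw i
    simp only [hΦ, Matrix.mulVecLin_apply, Matrix.mulVec, dotProduct, Matrix.of_apply,
      sum_blocks_mul, Pi.smul_apply, smul_eq_mul] at row
    have coeffs (i : Fin s) (k : Fin 4) := congrArg (coeff (Finsupp.single k 1)) (row i)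
    simp only [add_mul, mul_assoc, coeff_add, coeff_sub, coeff_C_mul,
      coeff_single_one_X_mul, coeff_zero_C] at coeffs
    have hx := coeffs ⟨0, by omega⟩ 0
    have hy := coeffs ⟨1, hs⟩ 1
    have hz := coeffs ⟨1, hs⟩ 2
    have ht := coeffs ⟨0, by omega⟩ 3
    simp at hx hy hz ht
    exact ⟨by rw [← hx, ← hy, neg_neg], by rw [← ht, ← hz, neg_neg]⟩
  have h₀ := rel fun i => if (i : ℕ) = 0 then 1 else 0
  have h₁ := rel fun i => if (i : ℕ) = 1 then 1 else 0
  simp at h₀ h₁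
  exact ⟨h₀.1, h₁.1, h₁.2, h₀.2⟩
end

section
/- Let K be a field, R = K[x,y,z,t], and let s ≥ 3 be an integer. Let Φ_s : R^{2s+2} → R^s be the R-linear map given by the s×(2s+2) matrix [Y | Z], where Y is the s×(s+1) matrix with Y_{i,i} = y, Y_{i,i+1} = −x and zeros elsewhere, and Z is the s×(s+1) matrix with Z_{i,i} = z, Z_{i,i+1} = −t and zeros elsewhere. If q' ∈ R is a homogeneous polynomial of degree 2 such that q'·v ∈ im Φ_s for all v ∈ R^s, then q' is a K-scalar multiple of xz − yt. In other words, the degree-2 part of the annihilator of coker Φ_s is the one-dimensional K-vector space spanned by xz − yt. -/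
open MvPolynomial

/-- The coefficient of the quadratic monomial `X i * X j` in a multiple of a variable. -/
theorem coeff_single_add_single_X_mul {σ R : Type*} [DecidableEq σ] [CommSemiring R]
    (i j k : σ) (p : MvPolynomial σ R) :
    coeff (Finsupp.single i 1 + Finsupp.single j 1) (X k * p) =
      if k = i then coeff (Finsupp.single j 1) p
      else if k = j then coeff (Finsupp.single i 1) p else 0 := by
  split_ifs with hi hj
  · rw [hi, coeff_X_mul]
  · rw [hj, add_comm, coeff_X_mul]
  · rw [coeff_X_mul', if_neg]
    simp [Ne.symm hi, Ne.symm hj]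

/-- A quadratic form vanishes if all its coefficients vanish. -/
theorem MvPolynomial.IsHomogeneous.eq_zero_of_coeff_single_add_single {σ R : Type*}
    [CommSemiring R] {p : MvPolynomial σ R} (hp : p.IsHomogeneous 2)
    (h : ∀ i j, coeff (Finsupp.single i 1 + Finsupp.single j 1) p = 0) : p = 0 := by
  ext m
  rw [coeff_zero]
  by_contra hm
  have hdeg : m.degree = 2 := by
    by_contra hd
    exact hm (hp.coeff_eq_zero hd)
  obtain ⟨i, j, rfl⟩ : ∃ i j, m = Finsupp.single i 1 + Finsupp.single j 1 := by
    have hcard : m.toMultiset.card = 2 := by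
      rw [Finsupp.card_toMultiset, ← hdeg]
      rfl
    obtain ⟨i, j, hij⟩ := Multiset.card_eq_two.mp hcard
    classical
    refine ⟨i, j, ?_⟩
    rw [← Finsupp.toMultiset_toFinsupp m, hij, Multiset.insert_eq_cons,
      ← Multiset.singleton_add, map_add, Multiset.toFinsupp_singleton,
      Multiset.toFinsupp_singleton]
  exact hm (h i j)

/-- The entries of the image of `w` under a pair of bidiagonal blocks placed side by side. -/
theorem sum_bidiagonal_blocks_mul {R : Type*} [CommRing R] {s : ℕ} (a b c d : R)
    (w : Fin (2 * s + 2) → R) (i : Fin s) :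
    ∑ j : Fin (2 * s + 2),
      (if (j : ℕ) < s + 1 then
          (if (j : ℕ) = (i : ℕ) then b else if (j : ℕ) = (i : ℕ) + 1 then -a else 0)
        else
          (if (j : ℕ) = (s + 1) + (i : ℕ) then c
            else if (j : ℕ) = (s + 1) + (i : ℕ) + 1 then -d else 0)) * w j =
      b * w ⟨i, by omega⟩ - a * w ⟨i + 1, by omega⟩ +
        c * w ⟨s + 1 + i, by omega⟩ - d * w ⟨s + 1 + i + 1, by omega⟩ := by
  have hi := i.isLt
  have entry : ∀ j : Fin (2 * s + 2),
      (if (j : ℕ) < s + 1 then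
          (if (j : ℕ) = (i : ℕ) then b else if (j : ℕ) = (i : ℕ) + 1 then -a else 0)
        else
          (if (j : ℕ) = (s + 1) + (i : ℕ) then c
            else if (j : ℕ) = (s + 1) + (i : ℕ) + 1 then -d else 0)) * w j =
      (if j = ⟨i, by omega⟩ then b * w j else 0) - (if j = ⟨i + 1, by omega⟩ then a * w j else 0) +
        (if j = ⟨s + 1 + i, by omega⟩ then c * w j else 0) -
        (if j = ⟨s + 1 + i + 1, by omega⟩ then d * w j else 0) := by
    intro j
    simp only [Fin.ext_iff]
    split_ifs <;> first | omega | ring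
  simp only [entry, Finset.sum_sub_distrib, Finset.sum_add_distrib, Finset.sum_ite_eq',
    Finset.mem_univ, if_true]

/-- For `s ≥ 3`, the degree-2 part of the annihilator of the cokernel of the
presentation matrix `Φ_s = [Y | Z]` is spanned by the quadric `xz - yt`; hence the
quadric containing a minimal curve is determined by its Hartshorne–Rao module
(final assertion of Theorem 4.1 of "The equations of space curves on a quadric" by
Di Gennaro and Nagel). -/
theorem unique_quadric_annihilating_coker
    {K : Type*} [Field K] (s : ℕ) (hs : 3 ≤ s)
    (Φ : (Fin (2 * s + 2) → MvPolynomial (Fin 4) K) →ₗ[MvPolynomial (Fin 4) K]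
      (Fin s → MvPolynomial (Fin 4) K))
    (hΦ : Φ = Matrix.mulVecLin (Matrix.of
      (fun (i : Fin s) (j : Fin (2 * s + 2)) =>
        if (j : ℕ) < s + 1 then
          -- block Y
          (if (j : ℕ) = (i : ℕ) then X 1
           else if (j : ℕ) = (i : ℕ) + 1 then -(X 0) else 0)
        else
          -- block Z
          (if (j : ℕ) = (s + 1) + (i : ℕ) then X 2
           else if (j : ℕ) = (s + 1) + (i : ℕ) + 1 then -(X 3) else 0))))
    (q' : MvPolynomial (Fin 4) K) (hq' : q'.IsHomogeneous 2)
    (hann : ∀ v : Fin s → MvPolynomial (Fin 4) K, q' • v ∈ LinearMap.range Φ) :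
    ∃ c : K, q' = C c * (X 0 * X 2 - X 1 * X 3) := by
  subst hΦ
  let c (i j : Fin 4) : K := coeff (Finsupp.single i 1 + Finsupp.single j 1) q'
  have hrow (k : Fin s) : ∃ u v : ℕ → MvPolynomial (Fin 4) K, ∀ i : Fin s,
      (if i = k then q' else 0) =
        X 1 * u i - X 0 * u (i + 1) + X 2 * v i - X 3 * v (i + 1) := by
    obtain ⟨w, hw⟩ := hann (Pi.single k 1)
    refine ⟨fun n => if h : n < 2 * s + 2 then w ⟨n, h⟩ else 0,
      fun n => if h : s + 1 + n < 2 * s + 2 then w ⟨s + 1 + n, h⟩ else 0, fun i => ?_⟩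
    have hwi := congrFun hw i
    simp only [Matrix.mulVecLin_apply, Matrix.mulVec, dotProduct, Matrix.of_apply,
      sum_bidiagonal_blocks_mul, Pi.smul_apply, Pi.single_apply, smul_eq_mul, mul_ite, mul_one,
      mul_zero] at hwi
    have hi := i.isLt
    beta_reduce
    rw [← hwi, dif_pos (by omega), dif_pos (by omega), dif_pos (by omega), dif_pos (by omega)]
    simp only [add_assoc]
  have key (k : Fin s) :
      ((if (0 : ℕ) = k then c 0 0 else 0) + (if (1 : ℕ) = k then c 0 1 else 0) +
        (if (2 : ℕ) = k then c 1 1 else 0) = 0) ∧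
      ((if (0 : ℕ) = k then c 0 3 else 0) + (if (1 : ℕ) = k then c 0 2 + c 1 3 else 0) +
        (if (2 : ℕ) = k then c 1 2 else 0) = 0) ∧
      ((if (0 : ℕ) = k then c 3 3 else 0) + (if (1 : ℕ) = k then c 2 3 else 0) +
        (if (2 : ℕ) = k then c 2 2 else 0) = 0) := by
    obtain ⟨u, v, h⟩ := hrow k
    have hc (i : Fin s) (a b : Fin 4) := congrArg
      (coeff (Finsupp.single a 1 + Finsupp.single b 1)) (h i)
    simp only [apply_ite (coeff _), coeff_zero, coeff_add, coeff_sub,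
      coeff_single_add_single_X_mul, Fin.ext_iff] at hc
    have h0 := hc ⟨0, by omega⟩
    have h1 := hc ⟨1, by omega⟩
    have h2 := hc ⟨2, by omega⟩
    have a1 := h0 0 0
    have a2 := h1 0 1
    have a3 := h2 1 1
    have b1 := h0 0 3
    have b2 := h1 0 2
    have b3 := h1 1 3
    have b4 := h2 1 2
    have c1 := h0 3 3
    have c2 := h1 2 3
    have c3 := h2 2 2
    have hsplit : (if (1 : ℕ) = k then c 0 2 + c 1 3 else 0) =
        (if (1 : ℕ) = k then c 0 2 else 0) + (if (1 : ℕ) = k then c 1 3 else 0) := by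
      split_ifs <;> simp
    simp only [c] at hsplit ⊢
    rw [hsplit, a1, a2, a3, b1, b2, b3, b4, c1, c2, c3]
    refine ⟨?_, ?_, ?_⟩ <;> simp <;> ring
  obtain ⟨h00, h03, h33⟩ := key ⟨0, by omega⟩
  obtain ⟨h01, h02, h23⟩ := key ⟨1, by omega⟩
  obtain ⟨h11, h12, h22⟩ := key ⟨2, by omega⟩
  norm_num at h00 h03 h33 h01 h02 h23 h11 h12 h22
  have hsymm (i j : Fin 4) : c i j = c j i := by simp only [c, add_comm]
  refine ⟨c 0 2, sub_eq_zero.mp ?_⟩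
  have hquad : (C (c 0 2) * (X 0 * X 2 - X 1 * X 3) : MvPolynomial (Fin 4) K).IsHomogeneous 2 := by
    simpa using (isHomogeneous_C (Fin 4) (c 0 2)).mul
      (((isHomogeneous_X K (0 : Fin 4)).mul (isHomogeneous_X K 2)).sub
        ((isHomogeneous_X K (1 : Fin 4)).mul (isHomogeneous_X K 3)))
  refine (hq'.sub hquad).eq_zero_of_coeff_single_add_single fun i j => ?_
  rw [coeff_sub, coeff_C_mul, coeff_sub, coeff_single_add_single_X_mul,
    coeff_single_add_single_X_mul]
  change c i j - _ = 0
  simp only [coeff_X, Finsupp.single_left_inj one_ne_zero]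
  have h31 : c 1 3 = -c 0 2 := by linear_combination h02
  fin_cases i <;> fin_cases j <;>
    simp [h00, h03, h33, h01, h23, h11, h12, h22, h31, hsymm 1 0, hsymm 2 0, hsymm 3 0,
      hsymm 2 1, hsymm 3 1, hsymm 3 2]
end

section
/- Let R be a commutative ring and let x, p, h, F, G ∈ R be elements such that p² is a nonzerodivisor modulo the ideal (x, h), i.e. for all γ ∈ R, γ·p² ∈ (x, h) implies γ ∈ (x, h). Then the following equality of ideals of R holds: (x², xp, p²h, phF + xG) = (x², xp, p², phF + xG) ∩ (x, h). -/
theorem Ideal.mem_span_quadruple {R : Type*} [CommRing R] {a b c d y : R} :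
    y ∈ Ideal.span {a, b, c, d} ↔
      ∃ r s t u : R, r * a + s * b + t * c + u * d = y := by
  simp only [Ideal.mem_span_insert, Ideal.mem_span_singleton']
  constructor
  · rintro ⟨r, _, ⟨s, _, ⟨t, _, ⟨u, rfl⟩, rfl⟩, rfl⟩, rfl⟩
    exact ⟨r, s, t, u, by ring⟩
  · rintro ⟨r, s, t, u, rfl⟩
    exact ⟨r, _, ⟨s, _, ⟨t, _, ⟨u, rfl⟩, rfl⟩, rfl⟩, by ring⟩

/-- The ideal identity of Remark 5.2 of "The equations of space curves on a quadric"
by Di Gennaro and Nagel, describing a minimal curve in the even liaison class of a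
curve with cyclic Hartshorne–Rao module of type (i):
`(x², xp, p²h, phF + xG) = (x², xp, p², phF + xG) ∩ (x, h)`. -/
theorem minimal_curve_ideal_identity
    {R : Type*} [CommRing R] (x p h F G : R)
    (hreg : ∀ γ : R, γ * p ^ 2 ∈ Ideal.span {x, h} → γ ∈ Ideal.span {x, h}) :
    Ideal.span {x ^ 2, x * p, p ^ 2 * h, p * h * F + x * G} =
      Ideal.span {x ^ 2, x * p, p ^ 2, p * h * F + x * G} ⊓ Ideal.span {x, h} := by
  ext y
  simp only [Ideal.mem_inf, Ideal.mem_span_quadruple, Ideal.mem_span_pair] at hreg ⊢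
  constructor
  · rintro ⟨r, s, t, u, rfl⟩
    exact ⟨⟨r, s, t * h, u, by ring⟩,
      r * x + s * p + u * G, t * p ^ 2 + u * p * F, by ring⟩
  · rintro ⟨⟨r, s, t, u, rfl⟩, v, w, hvw⟩
    obtain ⟨m, n, rfl⟩ := hreg t
      ⟨v - r * x - s * p - u * G, w - u * p * F, by linear_combination hvw⟩
    exact ⟨r, s + m * p, n, u, by ring⟩
end
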